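/- arXiv:1005.5665 — 2 statements merged into one kernel-verified Lean document; each statement's English description precedes it below -/
import Mathlib

section
/- Let (X, M) be a centered jointly Gaussian random vector with values in ℝ^d × ℝ on a probability space (Ω, 𝓕, P). Let σ² = E[M²] and let c ∈ ℝ^d be the vector with components cᵢ = E[M·Xᵢ] for i = 1,…,d. Then for every bounded measurable function F : ℝ^d → ℝ one has E[F(X + c)] = E[F(X)·exp(M − σ²/2)]. In particular, for X a centered Gaussian vector with covariance matrix σ² and drift vector c, the law of X + c is absolutely continuous with respect to the law of X with density exp(M − σ²/2). -/
open MeasureTheory ProbabilityTheory Real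

/-- Two random variables with the same moment-generating function, finite everywhere, have the
same law. -/
lemma map_eq_of_mgf_eq {Ω Ω' : Type*} [MeasurableSpace Ω] [MeasurableSpace Ω']
    {μ : Measure Ω} {μ' : Measure Ω'} [IsProbabilityMeasure μ] [IsFiniteMeasure μ']
    {X : Ω → ℝ} {Y : Ω' → ℝ} (hX : AEMeasurable X μ) (hY : AEMeasurable Y μ')
    (hint : ∀ t, Integrable (fun ω => exp (t * X ω)) μ) (h : mgf X μ = mgf Y μ') :
    μ.map X = μ'.map Y := by
  have huniv : integrableExpSet X μ = Set.univ := Set.eq_univ_of_forall hint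
  refine Measure.ext_of_complexMGF_eq hX hY (funext fun z => eqOn_complexMGF_of_mgf h ?_)
  simp [huniv]

section CenteredGaussian

variable {Ω : Type*} [MeasurableSpace Ω] {P : Measure Ω} {Y M : Ω → ℝ} {v : NNReal}

lemma aemeasurable_of_map_eq_gaussianReal {m : ℝ} (h : P.map Y = gaussianReal m v) :
    AEMeasurable Y P :=
  aemeasurable_of_map_neZero (by rw [h]; infer_instance)

lemma memLp_two_of_map_eq_gaussianReal {m : ℝ} (h : P.map Y = gaussianReal m v) :
    MemLp Y 2 P := by
  have h2 : MemLp id 2 (P.map Y) := h ▸ memLp_id_gaussianReal 2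
  exact h2.comp_of_map (aemeasurable_of_map_eq_gaussianReal h)

lemma integrable_exp_of_map_eq_gaussianReal {m : ℝ} (h : P.map Y = gaussianReal m v) :
    Integrable (fun ω => exp (Y ω)) P := by
  have h1 : Integrable (fun x => exp (1 * x)) (P.map Y) := h ▸ integrable_exp_mul_gaussianReal 1
  simpa [Function.comp_def] using h1.comp_aemeasurable (aemeasurable_of_map_eq_gaussianReal h)

lemma integral_sq_of_map_eq_gaussianReal_zero (h : P.map Y = gaussianReal 0 v) :
    ∫ ω, Y ω ^ 2 ∂P = v := by
  rw [← integral_map (f := fun x : ℝ => x ^ 2) (aemeasurable_of_map_eq_gaussianReal h)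
    (by fun_prop), h, ← variance_of_integral_eq_zero aemeasurable_id' (by simp)]
  exact variance_fun_id_gaussianReal

lemma integral_exp_of_map_eq_gaussianReal_zero (h : P.map Y = gaussianReal 0 v) :
    ∫ ω, exp (Y ω) ∂P = exp ((∫ ω, Y ω ^ 2 ∂P) / 2) := by
  simpa [mgf, integral_sq_of_map_eq_gaussianReal_zero h] using mgf_gaussianReal h 1

/-- One-dimensional Gaussian shift: if `(Y, M)` is centered jointly Gaussian, then the law of `Y`
under the exponential tilting by `M` is the law of `Y + E[M * Y]`. -/
lemma map_add_integral_mul_eq_map_tilted [IsProbabilityMeasure P]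
    (h : ∀ s t : ℝ, ∃ v : NNReal, P.map (fun ω => s * Y ω + t * M ω) = gaussianReal 0 v) :
    P.map (fun ω => Y ω + ∫ ω', M ω' * Y ω' ∂P) = (P.tilted M).map Y := by
  obtain ⟨vY, hY⟩ : ∃ v : NNReal, P.map Y = gaussianReal 0 v := by simpa using h 1 0
  obtain ⟨vM, hM⟩ : ∃ v : NNReal, P.map M = gaussianReal 0 v := by simpa using h 0 1
  have hYt (t : ℝ) : ∃ v : NNReal, P.map (fun ω => t * Y ω) = gaussianReal 0 v := by
    simpa using h t 0
  have hYae := aemeasurable_of_map_eq_gaussianReal hY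
  have hYL := memLp_two_of_map_eq_gaussianReal hY
  have hML := memLp_two_of_map_eq_gaussianReal hM
  have := isProbabilityMeasure_tilted (integrable_exp_of_map_eq_gaussianReal hM)
  set a := ∫ ω, M ω * Y ω ∂P
  refine map_eq_of_mgf_eq (hYae.add_const a)
    (hYae.mono_ac (tilted_absolutelyContinuous P M)) (fun t => ?_) (funext fun t => ?_)
  · obtain ⟨v, hv⟩ := hYt t
    simpa only [mul_add, exp_add] using
      (integrable_exp_of_map_eq_gaussianReal hv).mul_const (exp (t * a))
  · obtain ⟨v, hv⟩ := hYt t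
    obtain ⟨w, hw⟩ : ∃ w : NNReal, P.map (fun ω => t * Y ω + M ω) = gaussianReal 0 w := by
      simpa using h t 1
    have hsq : ∫ ω, (t * Y ω + M ω) ^ 2 ∂P
        = ∫ ω, (t * Y ω) ^ 2 ∂P + 2 * t * a + ∫ ω, M ω ^ 2 ∂P := by
      have hi1 : Integrable (fun ω => (t * Y ω) ^ 2) P := (hYL.const_mul t).integrable_sq
      have hi2 : Integrable (fun ω => 2 * t * (M ω * Y ω)) P :=
        (hML.integrable_mul hYL).const_mul _
      rw [← integral_const_mul, ← integral_add hi1 hi2,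
        ← integral_add (by exact hi1.add hi2) hML.integrable_sq]
      congr with ω
      ring
    have hL : mgf (fun ω => Y ω + a) P t = exp ((∫ ω, (t * Y ω) ^ 2 ∂P) / 2) * exp (t * a) := by
      simp only [mgf, mul_add, exp_add, integral_mul_const,
        integral_exp_of_map_eq_gaussianReal_zero hv]
    have hR : mgf Y (P.tilted M) t
        = exp ((∫ ω, (t * Y ω + M ω) ^ 2 ∂P) / 2) / exp ((∫ ω, M ω ^ 2 ∂P) / 2) := by
      rw [mgf, integral_tilted, ← integral_exp_of_map_eq_gaussianReal_zero hw,
        ← integral_exp_of_map_eq_gaussianReal_zero hM, ← integral_div]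
      congr with ω
      rw [smul_eq_mul, exp_add]
      ring
    rw [hL, hR, hsq, ← exp_add, ← exp_sub]
    ring_nf

end CenteredGaussian




/-- **Finite-dimensional Girsanov / Cameron–Martin identity.**
Let `(X, M)` be a centered jointly Gaussian random vector with values in `ℝ^d × ℝ`
(i.e. every real linear functional of the pair has a centered real Gaussian law).
Let `σ² = E[M²]` and `c i = E[M * X i]`. Then for every bounded measurable
`F : ℝ^d → ℝ` one has `E[F(X + c)] = E[F(X) * exp(M - σ²/2)]`. -/
theorem girsanov_gaussian_shift
    {Ω : Type*} [MeasurableSpace Ω] (P : Measure Ω) [IsProbabilityMeasure P]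
    {d : ℕ} (X : Ω → (Fin d → ℝ)) (M : Ω → ℝ)
    (hX : Measurable X) (hM : Measurable M)
    (hGauss : ∀ L : ((Fin d → ℝ) × ℝ) →ₗ[ℝ] ℝ,
      ∃ v : NNReal, Measure.map (fun ω => L (X ω, M ω)) P = gaussianReal 0 v)
    (σ2 : ℝ) (hσ2 : σ2 = ∫ ω, (M ω) ^ 2 ∂P)
    (c : Fin d → ℝ) (hc : ∀ i, c i = ∫ ω, M ω * X ω i ∂P) :
    ∀ F : (Fin d → ℝ) → ℝ, Measurable F → (∃ C : ℝ, ∀ x, |F x| ≤ C) →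
      ∫ ω, F (X ω + c) ∂P = ∫ ω, F (X ω) * exp (M ω - σ2 / 2) ∂P := by
  rintro F hF -
  obtain ⟨v, hv⟩ : ∃ v : NNReal, P.map M = gaussianReal 0 v := by
    simpa using hGauss (LinearMap.snd ℝ _ _)
  have := isProbabilityMeasure_tilted (integrable_exp_of_map_eq_gaussianReal hv)
  have hML := memLp_two_of_map_eq_gaussianReal hv
  have hXL (i : Fin d) : MemLp (fun ω => X ω i) 2 P := by
    obtain ⟨w, hw⟩ := hGauss ((LinearMap.proj i).comp (LinearMap.fst ℝ _ _))
    exact memLp_two_of_map_eq_gaussianReal hw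
  have hLc (L : StrongDual ℝ (Fin d → ℝ)) : L c = ∫ ω, M ω * L (X ω) ∂P := by
    have hint : Integrable (fun ω => M ω • X ω) P :=
      Integrable.of_eval fun i => hML.integrable_mul (hXL i)
    have hc' : c = ∫ ω, M ω • X ω ∂P := by
      ext i
      rw [hc, eval_integral fun i => by exact hML.integrable_mul (hXL i)]
      rfl
    rw [hc', ← L.integral_comp_comm hint]
    simp
  have hlaw : P.map (fun ω => X ω + c) = (P.tilted M).map X := by
    have : IsProbabilityMeasure (P.map fun ω => X ω + c) :=
      Measure.isProbabilityMeasure_map (by fun_prop)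
    have : IsProbabilityMeasure ((P.tilted M).map X) :=
      Measure.isProbabilityMeasure_map hX.aemeasurable
    refine Measure.ext_of_charFunDual (funext fun L => ?_)
    rw [charFunDual_eq_charFun_map_one, charFunDual_eq_charFun_map_one,
      Measure.map_map (by fun_prop) (by fun_prop), Measure.map_map (by fun_prop) hX]
    have hshift := map_add_integral_mul_eq_map_tilted (P := P) (Y := fun ω => L (X ω)) (M := M)
      fun s t => by
        simpa using hGauss ((s • L.toLinearMap).coprod (LinearMap.mul ℝ ℝ t))
    simp only [← hLc] at hshift
    simp only [Function.comp_def, map_add, hshift]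
  calc ∫ ω, F (X ω + c) ∂P = ∫ x, F x ∂(P.map fun ω => X ω + c) :=
        (integral_map (by fun_prop) hF.aestronglyMeasurable).symm
    _ = ∫ ω, F (X ω) ∂(P.tilted M) := by
        rw [hlaw, integral_map hX.aemeasurable hF.aestronglyMeasurable]
    _ = ∫ ω, F (X ω) * exp (M ω - σ2 / 2) ∂P := by
        rw [integral_tilted, integral_exp_of_map_eq_gaussianReal_zero hv, ← hσ2]
        congr with ω
        rw [smul_eq_mul, exp_sub, mul_comm]
end

section
/- For every dimension d ≥ 2 and every ellipticity constant κ ∈ (0,1] there exists L₀ = L₀(κ, d) > 0 with the following property. Let L ≥ L₀, let a : ℝ^d → (symmetric d×d real matrices) be a smooth map satisfying κ|y|² ≤ y·a(x)y ≤ κ^{−1}|y|² for all x, y ∈ ℝ^d, and write points of ℝ^d as x = (x₁, z) with z ∈ ℝ^{d−1}. Let Π = {x ∈ ℝ^d : −L ≤ x₁ ≤ L} and let u : ℝ^d → ℝ be continuous on Π, twice continuously differentiable on the interior of Π, satisfy 0 ≤ u ≤ 1 on Π, solve the equation ∑_{i,j=1}^d ∂_i(a_{ij}(x) ∂_j u(x))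 + ∑_{j=1}^d a_{1j}(x) ∂_j u(x) = 0 on the interior of Π, and satisfy the boundary conditions u(−L, z) = 0 and u(L, z) = 1 for all z ∈ ℝ^{d−1}. Then u(0, z) ≥ 2/3 for every z ∈ ℝ^{d−1}. -/
open Real
open MeasureTheory Set Filter Topology

/-- The squared Euclidean norm of the gradient of `f` at `x`. -/
noncomputable def gradSq {d : ℕ} (f : (Fin d → ℝ) → ℝ) (x : Fin d → ℝ) : ℝ :=
  ∑ i, (fderiv ℝ f x (Pi.single i 1)) ^ 2

section Gradient

variable {d : ℕ} {f g : (Fin d → ℝ) → ℝ} {x : Fin d → ℝ}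

lemma gradSq_nonneg : 0 ≤ gradSq f x := Finset.sum_nonneg fun _ _ => sq_nonneg _

lemma gradSq_eq_zero_of_eventuallyEq_const {c : ℝ} (h : f =ᶠ[𝓝 x] fun _ => c) :
    gradSq f x = 0 := by
  simp [gradSq, h.fderiv_eq]

lemma continuous_gradSq (hf : ContDiff ℝ 1 f) : Continuous (gradSq f) := by
  unfold gradSq
  have := hf.continuous_fderiv one_ne_zero
  fun_prop

lemma gradSq_mul_le (hf : DifferentiableAt ℝ f x) (hg : DifferentiableAt ℝ g x) :
    gradSq (fun y => f y * g y) x ≤ 2 * (f x ^ 2 * gradSq g x + g x ^ 2 * gradSq f x) := by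
  simp only [gradSq, Finset.mul_sum, ← Finset.sum_add_distrib]
  refine Finset.sum_le_sum fun i _ => ?_
  rw [fderiv_fun_mul hf hg]
  simp only [add_apply, smul_apply, smul_eq_mul]
  nlinarith [sq_nonneg (f x * fderiv ℝ g x (Pi.single i 1) - g x * fderiv ℝ f x (Pi.single i 1))]

lemma gradSq_comp {φ : ℝ → ℝ} {φ' : ℝ} (hφ : HasDerivAt φ φ' (f x))
    (hf : DifferentiableAt ℝ f x) :
    gradSq (fun y => φ (f y)) x = φ' ^ 2 * gradSq f x := by
  have := (hφ.comp_hasFDerivAt x hf.hasFDerivAt).fderiv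
  simp only [Function.comp_def] at this
  simp [gradSq, this, Finset.mul_sum, mul_pow]

lemma gradSq_comp_sub (z : Fin d → ℝ) :
    gradSq (fun y => f (y - z)) x = gradSq f (x - z) := by
  simp [gradSq, fderiv_comp_sub]

lemma gradSq_comp_smul (c : ℝ) :
    gradSq (fun y => f (c • y)) x = c ^ 2 * gradSq f (c • x) := by
  have : fderiv ℝ (fun y => f (c • y)) x = c • fderiv ℝ f (c • x) := fderiv_comp_smul c
  simp [gradSq, this, Finset.mul_sum, mul_pow]

lemma gradSq_comp_apply {φ : ℝ → ℝ} {φ' : ℝ} (i : Fin d) (hφ : HasDerivAt φ φ' (x i)) :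
    gradSq (fun y => φ (y i)) x = φ' ^ 2 := by
  rw [gradSq_comp (f := fun y => y i) hφ (by fun_prop)]
  have : fderiv ℝ (fun y : Fin d → ℝ => y i) x = ContinuousLinearMap.proj i :=
    (ContinuousLinearMap.proj (R := ℝ) (φ := fun _ : Fin d => ℝ) i).hasFDerivAt.fderiv
  simp [gradSq, this, Pi.single_apply]

lemma norm_fderiv_sq_le : ‖fderiv ℝ f x‖ ^ 2 ≤ d * gradSq f x := by
  have h1 : ‖fderiv ℝ f x‖ ≤ ∑ i, |fderiv ℝ f x (Pi.single i 1)| := by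
    refine ContinuousLinearMap.opNorm_le_bound _ (by positivity) fun y => ?_
    have hy : fderiv ℝ f x y = ∑ i, y i * fderiv ℝ f x (Pi.single i 1) := by
      conv_lhs => rw [pi_eq_sum_univ' y]
      simp [map_sum]
    rw [hy, Finset.sum_mul]
    refine (norm_sum_le _ _).trans (Finset.sum_le_sum fun i _ => ?_)
    rw [norm_mul, mul_comm, Real.norm_eq_abs]
    gcongr
    exact norm_le_pi_norm y i
  calc ‖fderiv ℝ f x‖ ^ 2 ≤ (∑ i, |fderiv ℝ f x (Pi.single i 1)|) ^ 2 := by gcongr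
    _ ≤ d * gradSq f x := by
      simpa [gradSq] using sq_sum_le_card_mul_sum_sq (s := Finset.univ)
        (f := fun i => |fderiv ℝ f x (Pi.single i 1)|)

lemma integral_fderiv_apply_eq_zero (hf : ContDiff ℝ 1 f) (hc : HasCompactSupport f)
    (v : Fin d → ℝ) : ∫ y, fderiv ℝ f y v = 0 := by
  have hd := hf.continuous_fderiv one_ne_zero
  have hi : Integrable fun y => fderiv ℝ f y v :=
    (hd.clm_apply continuous_const).integrable_of_hasCompactSupport
      (hc.fderiv_apply (𝕜 := ℝ) v)
  have := integral_mul_fderiv_eq_neg_fderiv_mul_of_integrable (μ := (volume : Measure (Fin d → ℝ)))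
    (f := fun _ => (1 : ℝ)) (g := f) (v := v) (by simp) (by simpa using hi)
    (by simpa using hf.continuous.integrable_of_hasCompactSupport hc)
    (fun _ _ => differentiableAt_const _) (fun y _ => hf.differentiable one_ne_zero y)
  simpa using this

end Gradient

section ZeroExtension

lemma eventuallyEq_zero_off {X Y : Type*} [TopologicalSpace X] [Zero Y] {K : Set X} {f : X → Y}
    (hK : IsClosed K) (h0 : ∀ x ∉ K, f x = 0) {x : X} (hx : x ∉ K) : f =ᶠ[𝓝 x] fun _ => 0 :=
  Filter.eventuallyEq_of_mem (hK.isOpen_compl.mem_nhds hx) h0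

variable {E F : Type*} [NormedAddCommGroup E] [NormedSpace ℝ E] [NormedAddCommGroup F]
  [NormedSpace ℝ F] {U K : Set E} {f : E → F}

lemma ContDiffOn.contDiff_of_eq_zero_off {n : WithTop ℕ∞} (hU : IsOpen U) (hK : IsClosed K)
    (hKU : K ⊆ U) (h0 : ∀ x ∉ K, f x = 0) (hf : ContDiffOn ℝ n f U) : ContDiff ℝ n f := by
  rw [contDiff_iff_contDiffAt]
  intro x
  by_cases hx : x ∈ K
  · exact hf.contDiffAt (hU.mem_nhds (hKU hx))
  · exact contDiffAt_const.congr_of_eventuallyEq (eventuallyEq_zero_off hK h0 hx)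

lemma ContinuousOn.continuous_of_eq_zero_off (hU : IsOpen U) (hK : IsClosed K)
    (hKU : K ⊆ U) (h0 : ∀ x ∉ K, f x = 0) (hf : ContinuousOn f U) : Continuous f :=
  contDiff_zero.1 <| (contDiffOn_zero.2 hf).contDiff_of_eq_zero_off hU hK hKU h0

end ZeroExtension

section PosPartPower

lemma hasDerivAt_max_zero_rpow {p : ℝ} (hp : 1 < p) (t : ℝ) :
    HasDerivAt (fun t : ℝ => max t 0 ^ p) (p * max t 0 ^ (p - 1)) t := by
  rcases lt_trichotomy t 0 with ht | rfl | ht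
  · have h : (fun t : ℝ => max t 0 ^ p) =ᶠ[𝓝 t] fun _ => 0 := by
      filter_upwards [gt_mem_nhds ht] with s hs
      rw [max_eq_right hs.le, Real.zero_rpow (by linarith)]
    rw [max_eq_right ht.le, Real.zero_rpow (by linarith), mul_zero]
    exact (hasDerivAt_const t (0 : ℝ)).congr_of_eventuallyEq h
  · rw [max_self, Real.zero_rpow (by linarith), mul_zero]
    have h := (Real.hasDerivAt_rpow_const (x := 0) (p := p) (Or.inr hp.le))
    rw [Real.zero_rpow (by linarith), mul_zero] at h
    rw [hasDerivAt_iff_isLittleO] at h ⊢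
    refine (Asymptotics.IsBigO.of_bound 1 ?_).trans_isLittleO
      (h.comp_tendsto (k := fun t : ℝ => |t|)
        (by simpa using (continuous_abs.tendsto (0 : ℝ)))) |>.trans_isBigO ?_
    · refine Eventually.of_forall fun s => ?_
      simp only [max_self, Real.zero_rpow (show p ≠ 0 by linarith), smul_zero, sub_zero,
        Function.comp_def, one_mul, Real.norm_eq_abs]
      rw [abs_of_nonneg (by positivity), abs_of_nonneg (by positivity)]
      gcongr
      exact max_le (le_abs_self s) (abs_nonneg s)
    · refine Asymptotics.IsBigO.of_bound 1 (Eventually.of_forall fun s => ?_)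
      simp
  · have h : (fun t : ℝ => max t 0 ^ p) =ᶠ[𝓝 t] fun t => t ^ p := by
      filter_upwards [lt_mem_nhds ht] with s hs
      rw [max_eq_left hs.le]
    rw [max_eq_left ht.le]
    exact (Real.hasDerivAt_rpow_const (Or.inl ht.ne')).congr_of_eventuallyEq h

end PosPartPower

section Caccioppoli

lemma sum_sum_symm_bilin {ι : Type*} [Fintype ι] {b : ι → ι → ℝ} (hb : ∀ i j, b i j = b j i)
    (α β : ℝ) (p q : ι → ℝ) :
    ∑ i, ∑ j, (α * p i + β * q i) * b i j * (α * p j + β * q j) =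
      α ^ 2 * ∑ i, ∑ j, p i * b i j * p j + 2 * α * β * ∑ i, p i * ∑ j, b i j * q j
        + β ^ 2 * ∑ i, q i * ∑ j, b i j * q j := by
  have h : ∑ i, ∑ j, q i * b i j * p j = ∑ i, ∑ j, p i * b i j * q j := by
    rw [Finset.sum_comm]
    exact Finset.sum_congr rfl fun i _ => Finset.sum_congr rfl fun j _ => by rw [hb j i]; ring
  calc _ = α ^ 2 * ∑ i, ∑ j, p i * b i j * p j + α * β * ∑ i, ∑ j, p i * b i j * q j
        + α * β * ∑ i, ∑ j, q i * b i j * p j + β ^ 2 * ∑ i, ∑ j, q i * b i j * q j := by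
        simp only [Finset.mul_sum, ← Finset.sum_add_distrib]
        exact Finset.sum_congr rfl fun i _ => Finset.sum_congr rfl fun j _ => by ring
    _ = _ := by
        rw [h]
        simp only [Finset.mul_sum, ← Finset.sum_add_distrib]
        exact Finset.sum_congr rfl fun i _ => Finset.sum_congr rfl fun j _ => by ring

/-- `u` solves `div (a ∇u) + (a e_{i₀}) · ∇u = 0` on the open set `U`, for a symmetric matrix field
`a` with ellipticity constant `κ`. -/
structure IsEllipticSolution {d : ℕ} (κ : ℝ) (i₀ : Fin d) (a : (Fin d → ℝ) → Fin d → Fin d → ℝ)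
    (U : Set (Fin d → ℝ)) (u : (Fin d → ℝ) → ℝ) : Prop where
  contDiff_coeff : ContDiff ℝ 1 a
  symm : ∀ x i j, a x i j = a x j i
  elliptic : ∀ x y : Fin d → ℝ, κ * ∑ i, (y i) ^ 2 ≤ ∑ i, ∑ j, y i * a x i j * y j ∧
    ∑ i, ∑ j, y i * a x i j * y j ≤ κ⁻¹ * ∑ i, (y i) ^ 2
  isOpen : IsOpen U
  contDiffOn : ContDiffOn ℝ 2 u U
  equation : ∀ x ∈ U, (∑ i, fderiv ℝ (fun y => ∑ j, a y i j * fderiv ℝ u y (Pi.single j 1))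
    x (Pi.single i 1)) + ∑ j, a x i₀ j * fderiv ℝ u x (Pi.single j 1) = 0

variable {d : ℕ} {i₀ : Fin d} {κ : ℝ} {a : (Fin d → ℝ) → Fin d → Fin d → ℝ}
  {U K : Set (Fin d → ℝ)} {u η : (Fin d → ℝ) → ℝ} {Φ Φ' H' : ℝ → ℝ}

/-- The divergence of `exp (x i₀) η² Φ(u) Φ'(u) a ∇u`, where
`div (a ∇u) + (a e_{i₀}) · ∇u = 0`. -/
lemma sum_fderiv_flux (ha : ContDiff ℝ 1 a) (hU : IsOpen U) (hu : ContDiffOn ℝ 2 u U)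
    (hpde : ∀ x ∈ U, (∑ i, fderiv ℝ (fun y => ∑ j, a y i j * fderiv ℝ u y (Pi.single j 1))
      x (Pi.single i 1)) + ∑ j, a x i₀ j * fderiv ℝ u x (Pi.single j 1) = 0)
    {H : ℝ → ℝ} (hH : ∀ t, HasDerivAt H (H' t) t) (hη : ContDiff ℝ 1 η)
    {x : Fin d → ℝ} (hx : x ∈ U) :
    ∑ i, fderiv ℝ (fun y => (exp (y i₀) * (η y ^ 2 * H (u y))) *
        ∑ j, a y i j * fderiv ℝ u y (Pi.single j 1)) x (Pi.single i 1) =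
      exp (x i₀) * (∑ i, (2 * η x * H (u x) * fderiv ℝ η x (Pi.single i 1) +
        η x ^ 2 * H' (u x) * fderiv ℝ u x (Pi.single i 1)) *
          ∑ j, a x i j * fderiv ℝ u x (Pi.single j 1)) := by
  have hdu : DifferentiableAt ℝ u x := (hu.differentiableOn two_ne_zero).differentiableAt (hU.mem_nhds hx)
  have hdη : DifferentiableAt ℝ η x := hη.differentiable one_ne_zero x
  have hW : ∀ i, DifferentiableAt ℝ (fun y => ∑ j, a y i j * fderiv ℝ u y (Pi.single j 1)) x := by
    intro i
    have h1 : DifferentiableAt ℝ (fderiv ℝ u) x :=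
      ((hu.fderiv_of_isOpen (m := 1) hU (by norm_num)).differentiableOn one_ne_zero).differentiableAt
        (hU.mem_nhds hx)
    have h2 : DifferentiableAt ℝ a x := ha.differentiable one_ne_zero x
    have h3 : ∀ j, DifferentiableAt ℝ (fun y => a y i j) x := fun j => by fun_prop
    fun_prop
  have hexp : HasFDerivAt (fun y : Fin d → ℝ => exp (y i₀))
      (exp (x i₀) • (ContinuousLinearMap.proj i₀ : (Fin d → ℝ) →L[ℝ] ℝ)) x :=
    ((ContinuousLinearMap.proj (R := ℝ) (φ := fun _ : Fin d => ℝ) i₀).hasFDerivAt).exp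
  have hP := hexp.mul ((hdη.hasFDerivAt.pow 2).mul ((hH (u x)).comp_hasFDerivAt x hdu.hasFDerivAt))
  have key : ∀ i, fderiv ℝ (fun y => (exp (y i₀) * (η y ^ 2 * H (u y))) *
        ∑ j, a y i j * fderiv ℝ u y (Pi.single j 1)) x (Pi.single i 1) =
      (exp (x i₀) * (η x ^ 2 * H (u x))) *
        fderiv ℝ (fun y => ∑ j, a y i j * fderiv ℝ u y (Pi.single j 1)) x (Pi.single i 1) +
      (if i = i₀ then (exp (x i₀) * (η x ^ 2 * H (u x))) *
        ∑ j, a x i j * fderiv ℝ u x (Pi.single j 1) else 0) +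
      exp (x i₀) * ((2 * η x * H (u x) * fderiv ℝ η x (Pi.single i 1) +
        η x ^ 2 * H' (u x) * fderiv ℝ u x (Pi.single i 1)) *
          ∑ j, a x i j * fderiv ℝ u x (Pi.single j 1)) := by
    intro i
    have := (hP.mul (hW i).hasFDerivAt).fderiv
    simp only [Function.comp_def, Pi.mul_def] at this
    rw [this]
    simp only [add_apply, smul_apply, smul_eq_mul, ContinuousLinearMap.proj_apply, Pi.single_apply,
      eq_comm (a := i₀)]
    split_ifs <;> simp <;> ring
  simp only [key, Finset.sum_add_distrib, ← Finset.mul_sum, Finset.sum_ite_eq', Finset.mem_univ,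
    if_true]
  linear_combination (exp (x i₀) * (η x ^ 2 * H (u x))) * hpde x hx

/-- **Caccioppoli inequality** with the weight `exp (x i₀)` that makes
`div (a ∇u) + (a e_{i₀}) · ∇u = 0` self-adjoint, for the subsolution `Φ(u)`. -/
theorem caccioppoli (hκ : 0 < κ) (hs : IsEllipticSolution κ i₀ a U u)
    (hΦ : ∀ t, HasDerivAt Φ (Φ' t) t) (hΦ' : Continuous Φ')
    (hH : ∀ t, HasDerivAt (fun t => Φ t * Φ' t) (H' t) t) (hH' : Continuous H')
    (hle : ∀ t, Φ' t ^ 2 ≤ H' t) (hη : ContDiff ℝ 1 η)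
    (hK : IsCompact K) (hKU : K ⊆ U)
    (h0 : ∀ x ∉ K, η x * U.indicator (fun y => Φ (u y)) x = 0) :
    ContDiff ℝ 1 (fun x => η x * U.indicator (fun y => Φ (u y)) x) ∧
    Integrable (fun x => exp (x i₀) * (U.indicator (fun y => Φ (u y)) x ^ 2 * gradSq η x)) ∧
    ∫ x, exp (x i₀) * gradSq (fun x => η x * U.indicator (fun y => Φ (u y)) x) x ≤
      κ⁻¹ ^ 2 * ∫ x, exp (x i₀) * (U.indicator (fun y => Φ (u y)) x ^ 2 * gradSq η x) := by
  obtain ⟨ha, hsymm, hell, hU, hu, hpde⟩ := hs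
  set v := U.indicator (fun y => Φ (u y)) with hv
  have hvU : ∀ x ∈ U, v x = Φ (u x) := fun x hx => indicator_of_mem hx _
  have hu1 : ContDiffOn ℝ 1 u U := hu.of_le (by norm_num)
  have hΦ1 : ContDiff ℝ 1 Φ := by
    rw [contDiff_one_iff_deriv]
    exact ⟨fun t => (hΦ t).differentiableAt, by rwa [funext fun t => (hΦ t).deriv]⟩
  have hH1 : ContDiff ℝ 1 (fun t => Φ t * Φ' t) := by
    rw [contDiff_one_iff_deriv]
    exact ⟨fun t => (hH t).differentiableAt, by rwa [funext fun t => (hH t).deriv]⟩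
  have hv1 : ContDiffOn ℝ 1 v U := (hΦ1.comp_contDiffOn hu1).congr hvU
  have hg1 : ContDiff ℝ 1 (fun x => η x * v x) :=
    (hη.contDiffOn.mul hv1).contDiff_of_eq_zero_off hU hK.isClosed hKU h0
  have hgc : HasCompactSupport (fun x => η x * v x) := .intro hK h0
  have hR0 : ∀ x ∉ K, exp (x i₀) * (v x ^ 2 * gradSq η x) = 0 := by
    intro x hx
    by_cases hvx : v x = 0
    · simp [hvx]
    have hxU : x ∈ U := by
      by_contra h
      exact hvx (indicator_of_notMem h _)
    have : η =ᶠ[𝓝 x] fun _ => 0 := by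
      filter_upwards [(hv1.continuousOn.continuousAt (hU.mem_nhds hxU)).eventually_ne hvx,
        hK.isClosed.isOpen_compl.mem_nhds hx] with y hy1 hy2
      exact (mul_eq_zero.1 (h0 y hy2)).resolve_right hy1
    simp [gradSq_eq_zero_of_eventuallyEq_const this]
  have hRc : Continuous fun x => exp (x i₀) * (v x ^ 2 * gradSq η x) := by
    refine ContinuousOn.continuous_of_eq_zero_off hU hK.isClosed hKU hR0 ?_
    have h1 := continuous_gradSq hη
    have h2 := hv1.continuousOn
    fun_prop
  have hRi : Integrable fun x => exp (x i₀) * (v x ^ 2 * gradSq η x) :=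
    hRc.integrable_of_hasCompactSupport (.intro hK hR0)
  refine ⟨hg1, hRi, ?_⟩
  set G : Fin d → (Fin d → ℝ) → ℝ := fun i => U.indicator fun y =>
    (exp (y i₀) * (η y ^ 2 * (Φ (u y) * Φ' (u y)))) *
        ∑ j, a y i j * fderiv ℝ u y (Pi.single j 1) with hG
  have hG0 : ∀ i, ∀ x ∉ K, G i x = 0 := by
    intro i x hx
    by_cases hxU : x ∈ U
    · rw [hG]
      simp only [indicator_of_mem hxU]
      have := h0 x hx
      rw [hvU x hxU] at this
      linear_combination exp (x i₀) * η x * Φ' (u x) *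
        (∑ j, a x i j * fderiv ℝ u x (Pi.single j 1)) * this
    · exact indicator_of_notMem hxU _
  have hG1 : ∀ i, ContDiff ℝ 1 (G i) := by
    intro i
    refine ContDiffOn.contDiff_of_eq_zero_off hU hK.isClosed hKU (hG0 i) ?_
    refine ContDiffOn.congr ?_ fun x hx => indicator_of_mem hx _
    have h1 : ContDiffOn ℝ 1 (fderiv ℝ u) U := hu.fderiv_of_isOpen (m := 1) hU (by norm_num)
    have h2 : ContDiffOn ℝ 1 (fun y => Φ (u y) * Φ' (u y)) U := hH1.comp_contDiffOn hu1
    have h3 : ∀ j, ContDiff ℝ 1 (fun y => a y i j) := fun j => by fun_prop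
    have h4 : ∀ j, ContDiffOn ℝ 1 (fun y => a y i j) U := fun j => (h3 j).contDiffOn
    have h5 : ContDiffOn ℝ 1 (fun y : Fin d → ℝ => exp (y i₀)) U := by fun_prop
    refine (h5.mul ((hη.contDiffOn.pow 2).mul h2)).mul (ContDiffOn.sum fun j _ => ?_)
    exact (h4 j).mul (h1.clm_apply contDiffOn_const)
  have hGc : ∀ i, HasCompactSupport (G i) := fun i => .intro hK (hG0 i)
  have hGi : ∀ i, Integrable fun x => fderiv ℝ (G i) x (Pi.single i 1) := fun i =>
    (((hG1 i).continuous_fderiv one_ne_zero).clm_apply continuous_const).integrable_of_hasCompactSupport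
      ((hGc i).fderiv_apply (𝕜 := ℝ) _)
  have hdiv : ∫ x, ∑ i, fderiv ℝ (G i) x (Pi.single i 1) = 0 := by
    rw [integral_finsetSum _ fun i _ => hGi i]
    exact Finset.sum_eq_zero fun i _ => integral_fderiv_apply_eq_zero (hG1 i) (hGc i) _
  have hpt : ∀ x, κ * (exp (x i₀) * gradSq (fun x => η x * v x) x) ≤
      (∑ i, fderiv ℝ (G i) x (Pi.single i 1)) +
        κ⁻¹ * (exp (x i₀) * (v x ^ 2 * gradSq η x)) := by
    intro x
    by_cases hxU : x ∈ U
    · have hGx : ∀ i, fderiv ℝ (G i) x = fderiv ℝ (fun y =>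
          (exp (y i₀) * (η y ^ 2 * (Φ (u y) * Φ' (u y)))) *
            ∑ j, a y i j * fderiv ℝ u y (Pi.single j 1)) x := fun i =>
        Filter.EventuallyEq.fderiv_eq
          (Filter.eventuallyEq_of_mem (hU.mem_nhds hxU) fun y hy => indicator_of_mem hy _)
      simp only [hGx]
      rw [sum_fderiv_flux ha hU hu hpde hH hη hxU]
      have hdu : DifferentiableAt ℝ u x :=
        (hu.differentiableOn two_ne_zero).differentiableAt (hU.mem_nhds hxU)
      have hdg : ∀ i, fderiv ℝ (fun x => η x * v x) x (Pi.single i 1) =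
          Φ (u x) * fderiv ℝ η x (Pi.single i 1) +
            (η x * Φ' (u x)) * fderiv ℝ u x (Pi.single i 1) := by
        intro i
        have h1 : (fun x => η x * v x) =ᶠ[𝓝 x] fun x => η x * Φ (u x) :=
          Filter.eventuallyEq_of_mem (hU.mem_nhds hxU) fun y hy => by simp only [hvU y hy]
        have h2 := ((hη.differentiable one_ne_zero x).hasFDerivAt.mul
          ((hΦ (u x)).comp_hasFDerivAt x hdu.hasFDerivAt)).fderiv
        simp only [Function.comp_def, Pi.mul_def] at h2
        rw [h1.fderiv_eq, h2]
        simp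
        ring
      have e1 := (hell x fun i => Φ (u x) * fderiv ℝ η x (Pi.single i 1) +
            (η x * Φ' (u x)) * fderiv ℝ u x (Pi.single i 1)).1
      rw [sum_sum_symm_bilin (hsymm x)] at e1
      have e2 := (hell x fun i => fderiv ℝ η x (Pi.single i 1)).2
      have e3 := (hell x fun i => fderiv ℝ u x (Pi.single i 1)).1
      have e4 : 0 ≤ ∑ i, fderiv ℝ u x (Pi.single i 1) *
          ∑ j, a x i j * fderiv ℝ u x (Pi.single j 1) := by
        refine le_trans (by positivity) (e3.trans_eq ?_)
        simp only [Finset.mul_sum, mul_assoc]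
      simp only [gradSq, hdg, hvU x hxU] at e1 ⊢
      have e5 : ∑ i, (2 * η x * (Φ (u x) * Φ' (u x)) * fderiv ℝ η x (Pi.single i 1) +
          η x ^ 2 * H' (u x) * fderiv ℝ u x (Pi.single i 1)) *
            ∑ j, a x i j * fderiv ℝ u x (Pi.single j 1) =
          2 * η x * (Φ (u x) * Φ' (u x)) * (∑ i, fderiv ℝ η x (Pi.single i 1) *
            ∑ j, a x i j * fderiv ℝ u x (Pi.single j 1)) +
          η x ^ 2 * H' (u x) * (∑ i, fderiv ℝ u x (Pi.single i 1) *
            ∑ j, a x i j * fderiv ℝ u x (Pi.single j 1)) := by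
        rw [Finset.mul_sum, Finset.mul_sum, ← Finset.sum_add_distrib]
        exact Finset.sum_congr rfl fun i _ => by ring
      rw [e5]
      have e6 := mul_le_mul_of_nonneg_right (mul_le_mul_of_nonneg_left (hle (u x)) (sq_nonneg (η x))) e4
      have e7 := mul_le_mul_of_nonneg_left e2 (sq_nonneg (Φ (u x)))
      have e8 : 0 ≤ exp (x i₀) := (exp_pos _).le
      have core : κ * ∑ i, (Φ (u x) * fderiv ℝ η x (Pi.single i 1) +
            (η x * Φ' (u x)) * fderiv ℝ u x (Pi.single i 1)) ^ 2 ≤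
          (2 * η x * (Φ (u x) * Φ' (u x)) * (∑ i, fderiv ℝ η x (Pi.single i 1) *
            ∑ j, a x i j * fderiv ℝ u x (Pi.single j 1)) +
          η x ^ 2 * H' (u x) * (∑ i, fderiv ℝ u x (Pi.single i 1) *
            ∑ j, a x i j * fderiv ℝ u x (Pi.single j 1))) +
          κ⁻¹ * (Φ (u x) ^ 2 * ∑ i, fderiv ℝ η x (Pi.single i 1) ^ 2) := by
        linarith
      have := mul_le_mul_of_nonneg_left core e8
      linarith
    · have hxK : x ∉ K := fun h => hxU (hKU h)
      have h1 : ∀ i, fderiv ℝ (G i) x = 0 := fun i => by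
        simp [(eventuallyEq_zero_off hK.isClosed (hG0 i) hxK).fderiv_eq]
      rw [gradSq_eq_zero_of_eventuallyEq_const (eventuallyEq_zero_off hK.isClosed h0 hxK)]
      simp [h1, hR0 x hxK]
  have hLi : Integrable fun x => exp (x i₀) * gradSq (fun x => η x * v x) x := by
    refine Continuous.integrable_of_hasCompactSupport ?_ (.intro hK fun x hx => ?_)
    · have := continuous_gradSq hg1
      fun_prop
    · rw [gradSq_eq_zero_of_eventuallyEq_const (eventuallyEq_zero_off hK.isClosed h0 hx), mul_zero]
  have hint := integral_mono (hLi.const_mul κ)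
    ((integrable_finsetSum _ fun i _ => hGi i).add (hRi.const_mul κ⁻¹)) hpt
  simp only [Pi.add_apply] at hint
  rw [integral_add (integrable_finsetSum _ fun i _ => hGi i) (hRi.const_mul κ⁻¹), hdiv, zero_add,
    integral_const_mul, integral_const_mul] at hint
  calc _ = κ⁻¹ * (κ * ∫ x, exp (x i₀) * gradSq (fun x => η x * v x) x) := by field_simp
    _ ≤ κ⁻¹ * (κ⁻¹ * ∫ x, exp (x i₀) * (v x ^ 2 * gradSq η x)) := by gcongr
    _ = _ := by ring

end Caccioppoli

section FunctionalInequalities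

variable {d : ℕ} {g : (Fin d → ℝ) → ℝ}

/-- A one-dimensional Hardy inequality with exponential weight. -/
lemma integral_exp_mul_sq_le (i₀ : Fin d) (hg : ContDiff ℝ 1 g) (hc : HasCompactSupport g) :
    ∫ x, exp (x i₀) * g x ^ 2 ≤ 4 * ∫ x, exp (x i₀) * gradSq g x := by
  have hF : ContDiff ℝ 1 fun x : Fin d → ℝ => exp (x i₀) * g x ^ 2 := by fun_prop
  have hFc : HasCompactSupport fun x : Fin d → ℝ => exp (x i₀) * g x ^ 2 :=
    .intro hc fun x hx => by simp [image_eq_zero_of_notMem_tsupport hx]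
  have h1 : Integrable fun x : Fin d → ℝ => exp (x i₀) * g x ^ 2 :=
    hF.continuous.integrable_of_hasCompactSupport hFc
  have h2 : Integrable fun x : Fin d → ℝ => exp (x i₀) * gradSq g x := by
    refine Continuous.integrable_of_hasCompactSupport ?_ (.intro hc fun x hx => ?_)
    · have := continuous_gradSq hg
      fun_prop
    · rw [gradSq_eq_zero_of_eventuallyEq_const (eventuallyEq_zero_off (isClosed_tsupport g)
        (fun y hy => image_eq_zero_of_notMem_tsupport hy) hx), mul_zero]
  have h3 : Integrable fun x => fderiv ℝ (fun x : Fin d → ℝ => exp (x i₀) * g x ^ 2) x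
      (Pi.single i₀ 1) :=
    ((hF.continuous_fderiv one_ne_zero).clm_apply continuous_const).integrable_of_hasCompactSupport
      (hFc.fderiv_apply (𝕜 := ℝ) _)
  have hpt : ∀ x, exp (x i₀) * g x ^ 2 ≤ 4 * (exp (x i₀) * gradSq g x) +
      2 * fderiv ℝ (fun x : Fin d → ℝ => exp (x i₀) * g x ^ 2) x (Pi.single i₀ 1) := by
    intro x
    have hexp : HasFDerivAt (fun y : Fin d → ℝ => exp (y i₀))
        (exp (x i₀) • (ContinuousLinearMap.proj i₀ : (Fin d → ℝ) →L[ℝ] ℝ)) x :=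
      ((ContinuousLinearMap.proj (R := ℝ) (φ := fun _ : Fin d => ℝ) i₀).hasFDerivAt).exp
    have h := (hexp.mul ((hg.differentiable one_ne_zero x).hasFDerivAt.pow 2)).fderiv
    simp only [Pi.mul_def] at h
    rw [h]
    have h4 : fderiv ℝ g x (Pi.single i₀ 1) ^ 2 ≤ gradSq g x :=
      Finset.single_le_sum (f := fun i => fderiv ℝ g x (Pi.single i 1) ^ 2)
        (fun i _ => sq_nonneg _) (Finset.mem_univ i₀)
    simp only [add_apply, smul_apply, smul_eq_mul, ContinuousLinearMap.proj_apply, Pi.single_eq_same]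
    norm_num
    have h5 : g x ^ 2 ≤ 4 * gradSq g x +
        2 * (2 * g x * fderiv ℝ g x (Pi.single i₀ 1) + g x ^ 2) := by
      nlinarith [sq_nonneg (g x + 2 * fderiv ℝ g x (Pi.single i₀ 1))]
    have := mul_le_mul_of_nonneg_left h5 (exp_pos (x i₀)).le
    linarith
  have hint := integral_mono h1 ((h2.const_mul 4).add (h3.const_mul 2)) hpt
  simp only [Pi.add_apply] at hint
  rwa [integral_add (h2.const_mul 4) (h3.const_mul 2), integral_const_mul, integral_const_mul,
    integral_fderiv_apply_eq_zero hF hFc, mul_zero, add_zero] at hint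

lemma gradSq_sq (hg : DifferentiableAt ℝ g x) :
    gradSq (fun y => g y ^ 2) x = 4 * g x ^ 2 * gradSq g x := by
  rw [gradSq_comp (φ := fun t => t ^ 2) (by simpa using hasDerivAt_pow 2 (g x)) hg]
  ring

/-- The Gagliardo–Nirenberg–Sobolev inequality applied to the square of a function. -/
lemma integral_sq_rpow_le (hd : 2 ≤ d) (hg : ContDiff ℝ 1 g) (hc : HasCompactSupport g) :
    ∫ x, (g x ^ 2) ^ ((d : ℝ) / (d - 1)) ≤
      (d * ∫ x, (g x ^ 2 + gradSq g x)) ^ ((d : ℝ) / (d - 1)) := by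
  have hd' : (2 : ℝ) ≤ d := by exact_mod_cast hd
  set p : ℝ := (d : ℝ) / (d - 1)
  have hp0 : 0 < p := div_pos (by linarith) (by linarith)
  have hp : Real.HolderConjugate (Fintype.card (Fin d)) p := by
    rw [Fintype.card_fin]
    exact Real.HolderConjugate.conjExponent (by linarith)
  have hc2 : HasCompactSupport fun x => g x ^ 2 :=
    .intro hc fun x hx => by simp [image_eq_zero_of_notMem_tsupport hx]
  have hS := lintegral_pow_le_pow_lintegral_fderiv_aux hp (hg.pow 2) hc2
  have hi1 : Integrable fun x => (g x ^ 2) ^ p := by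
    refine Continuous.integrable_of_hasCompactSupport ?_ (.intro hc fun x hx => ?_)
    · exact (hg.continuous.pow 2).rpow_const fun x => Or.inr hp0.le
    · simp [image_eq_zero_of_notMem_tsupport hx, hp0.ne']
  have hi2 : Integrable fun x => (d : ℝ) * (g x ^ 2 + gradSq g x) := by
    refine Continuous.integrable_of_hasCompactSupport ?_ (.intro hc fun x hx => ?_)
    · have := continuous_gradSq hg
      have := hg.continuous
      fun_prop
    · rw [gradSq_eq_zero_of_eventuallyEq_const (eventuallyEq_zero_off (isClosed_tsupport g)
        (fun y hy => image_eq_zero_of_notMem_tsupport hy) hx)]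
      simp [image_eq_zero_of_notMem_tsupport hx]
  have hn2 : ∀ x, 0 ≤ (d : ℝ) * (g x ^ 2 + gradSq g x) := fun x => by
    have := gradSq_nonneg (f := g) (x := x)
    positivity
  have hbound : ∀ x, ‖fderiv ℝ (fun x => g x ^ 2) x‖ ≤ d * (g x ^ 2 + gradSq g x) := by
    intro x
    refine abs_le_of_sq_le_sq' ?_ (hn2 x) |>.2
    refine norm_fderiv_sq_le.trans ?_
    rw [gradSq_sq (hg.differentiable one_ne_zero x)]
    have := gradSq_nonneg (f := g) (x := x)
    nlinarith [sq_nonneg (g x ^ 2 - gradSq g x), mul_nonneg (sq_nonneg (g x)) this,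
      mul_nonneg (mul_nonneg (by positivity : (0:ℝ) ≤ d) (by linarith : (0:ℝ) ≤ (d:ℝ) - 1))
        (sq_nonneg (g x ^ 2 + gradSq g x)), mul_nonneg (by positivity : (0:ℝ) ≤ d)
          (sq_nonneg (g x ^ 2 - gradSq g x))]
  have e1 : ∫⁻ x, ‖g x ^ 2‖ₑ ^ p = ENNReal.ofReal (∫ x, (g x ^ 2) ^ p) := by
    rw [ofReal_integral_eq_lintegral_ofReal hi1 (Eventually.of_forall fun x => by positivity)]
    refine lintegral_congr fun x => ?_
    rw [Real.enorm_eq_ofReal (by positivity), ENNReal.ofReal_rpow_of_nonneg (by positivity) hp0.le]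
  have e2 : ∫⁻ x, ‖fderiv ℝ (fun x => g x ^ 2) x‖ₑ ≤
      ENNReal.ofReal (∫ x, (d : ℝ) * (g x ^ 2 + gradSq g x)) := by
    rw [ofReal_integral_eq_lintegral_ofReal hi2 (Eventually.of_forall hn2)]
    refine lintegral_mono fun x => ?_
    rw [← ofReal_norm]
    exact ENNReal.ofReal_le_ofReal (hbound x)
  rw [e1] at hS
  have h3 := hS.trans (ENNReal.rpow_le_rpow e2 hp0.le)
  rw [ENNReal.ofReal_rpow_of_nonneg (integral_nonneg hn2) hp0.le] at h3
  rw [← integral_const_mul]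
  exact (ENNReal.ofReal_le_ofReal_iff (Real.rpow_nonneg (integral_nonneg hn2) _)).1 h3

end FunctionalInequalities

/-- Fast geometric convergence: a sequence satisfying a superlinear recursion tends to zero if it
starts small. -/
lemma exists_tendsto_zero_of_superlinear {γ C : ℝ} (hγ : 0 < γ) (hC : 0 < C) :
    ∃ δ > 0, ∀ A : ℕ → ℝ, (∀ k, 0 ≤ A k) → A 0 ≤ δ →
      (∀ k, A (k + 1) ≤ (C * 16 ^ k * A k) ^ (1 + γ)) → Tendsto A atTop (𝓝 0) := by
  set r : ℝ := (16 : ℝ) ^ (-γ⁻¹) / 16 with hr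
  have hr0 : 0 < r := by positivity
  have hr1 : r < 1 := by
    have : (16 : ℝ) ^ (-γ⁻¹) ≤ 1 :=
      Real.rpow_le_one_of_one_le_of_nonpos (by norm_num) (by simpa using hγ.le)
    rw [hr]
    linarith
  have hr2 : (16 * r) ^ γ = 16⁻¹ := by
    rw [hr, mul_div_cancel₀ _ (by norm_num : (16 : ℝ) ≠ 0), ← Real.rpow_mul (by norm_num),
      neg_mul, inv_mul_cancel₀ hγ.ne', Real.rpow_neg_one]
  set δ : ℝ := (r / C) ^ γ⁻¹ / C with hδ
  have hδ0 : 0 < δ := by positivity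
  have hδ2 : (C * δ) ^ γ = r / C := by
    rw [hδ, mul_div_cancel₀ _ hC.ne', ← Real.rpow_mul (by positivity), inv_mul_cancel₀ hγ.ne',
      Real.rpow_one]
  refine ⟨δ, hδ0, fun A hA0 hA hrec => ?_⟩
  have key : ∀ k, A k ≤ δ * r ^ k := by
    intro k
    induction k with
    | zero => simpa using hA
    | succ k ih =>
      have hy : 0 < C * 16 ^ k * (δ * r ^ k) := by positivity
      calc A (k + 1) ≤ (C * 16 ^ k * A k) ^ (1 + γ) := hrec k
        _ ≤ (C * 16 ^ k * (δ * r ^ k)) ^ (1 + γ) := by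
          have := hA0 k
          gcongr
        _ = C * 16 ^ k * (δ * r ^ k) * ((C * δ) * (16 * r) ^ k) ^ γ := by
          rw [Real.rpow_add hy, Real.rpow_one, mul_pow]
          congr 2
          ring
        _ = C * 16 ^ k * (δ * r ^ k) * ((r / C) * (16⁻¹) ^ k) := by
          rw [Real.mul_rpow (by positivity) (by positivity), hδ2,
            ← Real.rpow_pow_comm (by positivity), hr2]
        _ = δ * r ^ (k + 1) := by
          rw [inv_pow, pow_succ]
          field_simp
  refine squeeze_zero hA0 key ?_
  simpa using (tendsto_pow_atTop_nhds_zero_of_lt_one hr0.le hr1).const_mul δ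

section TestFunctions

lemma exists_cutoff (d : ℕ) : ∃ θ : (Fin d → ℝ) → ℝ, ∃ M : ℝ, ContDiff ℝ 1 θ ∧ 0 ≤ M ∧
    (∀ x, 0 ≤ θ x) ∧ (∀ x, θ x ≤ 1) ∧ (∀ x, ‖x‖ ≤ 1 → θ x = 1) ∧ (∀ x, 2 ≤ ‖x‖ → θ x = 0) ∧
    ∀ x, gradSq θ x ≤ M := by
  let b : ContDiffBump (0 : Fin d → ℝ) := ⟨1, 2, by norm_num, by norm_num⟩
  have hb : ContDiff ℝ 1 b := b.contDiff
  have hcs : HasCompactSupport (gradSq b) := by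
    refine .intro b.hasCompactSupport fun x hx => ?_
    exact gradSq_eq_zero_of_eventuallyEq_const (eventuallyEq_zero_off (isClosed_tsupport b)
        (fun y hy => image_eq_zero_of_notMem_tsupport hy) hx)
  obtain ⟨M, hM⟩ := hcs.exists_bound_of_continuous (continuous_gradSq hb)
  refine ⟨b, M, hb, (norm_nonneg _).trans (hM 0), fun x => b.nonneg, fun x => b.le_one,
    fun x hx => b.one_of_mem_closedBall (by simpa using hx), fun x hx => ?_,
    fun x => (le_abs_self _).trans (hM x)⟩
  exact b.zero_of_le_dist (by simpa using hx)

lemma exists_smoothTransition_deriv_sq_le :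
    ∃ M : ℝ, 0 ≤ M ∧ ∀ t, deriv Real.smoothTransition t ^ 2 ≤ M := by
  have hc : Continuous (deriv Real.smoothTransition) :=
    (Real.smoothTransition.contDiff (n := 1)).continuous_deriv le_rfl
  have hs : HasCompactSupport (deriv Real.smoothTransition) := by
    refine .intro (isCompact_Icc (a := (0 : ℝ)) (b := 1)) fun t ht => ?_
    rw [mem_Icc, not_and_or, not_le, not_le] at ht
    rcases ht with ht | ht
    · have : Real.smoothTransition =ᶠ[𝓝 t] fun _ => 0 := by
        filter_upwards [gt_mem_nhds ht] with s hs using Real.smoothTransition.zero_of_nonpos hs.le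
      simp [this.deriv_eq]
    · have : Real.smoothTransition =ᶠ[𝓝 t] fun _ => 1 := by
        filter_upwards [lt_mem_nhds ht] with s hs using Real.smoothTransition.one_of_one_le hs.le
      simp [this.deriv_eq]
  obtain ⟨M, hM⟩ := hs.exists_bound_of_continuous hc
  refine ⟨M ^ 2, sq_nonneg M, fun t => ?_⟩
  exact sq_le_sq' (neg_le_of_abs_le (hM t)) (le_of_abs_le (hM t))

/-- A positive, square integrable function with small logarithmic gradient. -/
lemma exists_slowly_varying (d : ℕ) {ε : ℝ} (hε : 0 < ε) :
    ∃ ψ : (Fin d → ℝ) → ℝ, ContDiff ℝ 1 ψ ∧ (∀ x, 0 < ψ x) ∧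
      (∀ x, gradSq ψ x ≤ ε * ψ x ^ 2) ∧ Integrable fun x => ψ x ^ 2 := by
  obtain ⟨b, hb0, hb1, hbε⟩ : ∃ b : ℝ, 0 < b ∧ b ≤ 1 ∧ (d + 1) ^ 2 * b ≤ ε := by
    refine ⟨min 1 (ε / (d + 1) ^ 2), by positivity, min_le_left _ _, ?_⟩
    calc _ ≤ ((d : ℝ) + 1) ^ 2 * (ε / (d + 1) ^ 2) := by gcongr; exact min_le_right _ _
      _ = ε := by field_simp
  let s : (Fin d → ℝ) → ℝ := fun x => ∑ i, x i ^ 2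
  have hs0 : ∀ x, 0 ≤ s x := fun x => Finset.sum_nonneg fun i _ => sq_nonneg _
  have hsC : ContDiff ℝ 1 s := by fun_prop
  have hgs : ∀ x, gradSq s x = 4 * s x := by
    intro x
    have : HasFDerivAt s (∑ i, (2 * x i) • (ContinuousLinearMap.proj i : (Fin d → ℝ) →L[ℝ] ℝ)) x := by
      refine HasFDerivAt.fun_sum fun i _ => ?_
      simpa using ((ContinuousLinearMap.proj (R := ℝ) (φ := fun _ : Fin d => ℝ) i).hasFDerivAt
        (x := x)).pow 2
    simp [gradSq, this.fderiv, s, Finset.mul_sum, Pi.single_apply, mul_pow]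
    norm_num
  have hpos : ∀ x, 0 < 1 + b * s x := fun x => by have := hs0 x; positivity
  refine ⟨fun x => ((1 + b * s x) ^ (d + 1))⁻¹, ?_, fun x => by have := hpos x; positivity, ?_, ?_⟩
  · exact (by fun_prop : ContDiff ℝ 1 fun x => (1 + b * s x) ^ (d + 1)).inv fun x =>
      (pow_pos (hpos x) _).ne'
  · intro x
    have hx := hpos x
    have h1 : HasDerivAt (fun t : ℝ => ((1 + b * t) ^ (d + 1))⁻¹)
        (-((d + 1) * (1 + b * s x) ^ d * b) / ((1 + b * s x) ^ (d + 1)) ^ 2) (s x) := by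
      have h2 : HasDerivAt (fun t : ℝ => 1 + b * t) b (s x) := by
        simpa using ((hasDerivAt_id (s x)).const_mul b).const_add 1
      simpa [Pi.inv_def, Pi.pow_def] using (h2.pow (d + 1)).inv (pow_pos hx _).ne'
    rw [gradSq_comp (φ := fun t : ℝ => ((1 + b * t) ^ (d + 1))⁻¹) h1
      (hsC.differentiable one_ne_zero x), hgs]
    have h3 : (-((d + 1) * (1 + b * s x) ^ d * b) / ((1 + b * s x) ^ (d + 1)) ^ 2) ^ 2 * (4 * s x)
        = ((d + 1) ^ 2 * b) * ((4 * (b * s x)) / (1 + b * s x) ^ 2) *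
          (((1 + b * s x) ^ (d + 1))⁻¹) ^ 2 := by
      rw [pow_succ _ d]
      field_simp
    rw [h3]
    gcongr
    have h4 : (4 * (b * s x)) / (1 + b * s x) ^ 2 ≤ 1 := by
      rw [div_le_one (by positivity)]
      nlinarith [sq_nonneg (1 - b * s x)]
    have h5 : 0 ≤ ((d : ℝ) + 1) ^ 2 * b := by positivity
    nlinarith
  · have hI := integrable_rpow_neg_one_add_norm_sq (E := Fin d → ℝ) (μ := volume)
      (r := 4 * (d + 1)) (by rw [Module.finrank_fin_fun]; linarith [Nat.cast_nonneg (α := ℝ) d])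
    refine (hI.const_mul ((b ^ (2 * (d + 1)))⁻¹)).mono' ?_ (Eventually.of_forall fun x => ?_)
    · refine Continuous.aestronglyMeasurable (Continuous.pow (Continuous.inv₀ ?_ fun x => ?_) 2)
      · have := hsC.continuous
        fun_prop
      · exact (pow_pos (hpos x) _).ne'
    · have hx := hpos x
      rw [Real.norm_of_nonneg (by positivity)]
      have hn : ‖x‖ ^ 2 ≤ s x := by
        refine (sq_le_sq₀ (norm_nonneg _) (Real.sqrt_nonneg _)).2 ?_ |>.trans_eq
          (Real.sq_sqrt (hs0 x))
        refine (pi_norm_le_iff_of_nonneg (Real.sqrt_nonneg _)).2 fun i => ?_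
        refine Real.abs_le_sqrt ?_
        exact Finset.single_le_sum (f := fun i => x i ^ 2) (fun i _ => sq_nonneg _)
          (Finset.mem_univ i)
      have e : -(4 * ((d : ℝ) + 1)) / 2 = -((2 * (d + 1) : ℕ) : ℝ) := by push_cast; ring
      rw [e, Real.rpow_neg (by positivity), Real.rpow_natCast, ← mul_inv, ← mul_pow, inv_pow,
        ← pow_mul, mul_comm (d + 1) 2]
      have : b * (1 + ‖x‖ ^ 2) ≤ 1 + b * s x := by nlinarith
      gcongr

end TestFunctions

section Excess

/-- The positive part of `3 (c - u)`, extended by zero outside `U`. -/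
noncomputable def excess {E : Type*} (U : Set E) (c : ℝ) (u : E → ℝ) : E → ℝ :=
  U.indicator fun y => max (3 * (c - u y)) 0

lemma excess_nonneg {E : Type*} {U : Set E} {c : ℝ} {u : E → ℝ} (x : E) : 0 ≤ excess U c u x :=
  indicator_nonneg (fun _ _ => le_max_right _ _) x

lemma continuousOn_excess {E : Type*} [TopologicalSpace E] {U : Set E} {c : ℝ} {u : E → ℝ}
    (hu : ContinuousOn u U) : ContinuousOn (excess U c u) U := by
  refine ContinuousOn.congr (f := fun y => max (3 * (c - u y)) 0) ?_
    fun x hx => indicator_of_mem hx _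
  fun_prop

variable {d : ℕ} {i₀ : Fin d} {κ c : ℝ} {a : (Fin d → ℝ) → Fin d → Fin d → ℝ}
  {U K : Set (Fin d → ℝ)} {u η : (Fin d → ℝ) → ℝ}

/-- The Caccioppoli inequality for powers of the excess. -/
lemma caccioppoli_excess {q : ℝ} (hq : 2 ≤ q) (hκ : 0 < κ) (hs : IsEllipticSolution κ i₀ a U u)
    (hη : ContDiff ℝ 1 η) (hK : IsCompact K) (hKU : K ⊆ U)
    (h0 : ∀ x ∉ K, η x * excess U c u x ^ q = 0) :
    ContDiff ℝ 1 (fun x => η x * excess U c u x ^ q) ∧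
    Integrable (fun x => exp (x i₀) * ((excess U c u x ^ q) ^ 2 * gradSq η x)) ∧
    ∫ x, exp (x i₀) * gradSq (fun x => η x * excess U c u x ^ q) x ≤
      κ⁻¹ ^ 2 * ∫ x, exp (x i₀) * ((excess U c u x ^ q) ^ 2 * gradSq η x) := by
  let Φ : ℝ → ℝ := fun t => max (3 * (c - t)) 0 ^ q
  let Φ' : ℝ → ℝ := fun t => -3 * q * max (3 * (c - t)) 0 ^ (q - 1)
  let H' : ℝ → ℝ := fun t => 9 * q * (2 * q - 1) * max (3 * (c - t)) 0 ^ (2 * q - 2)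
  have hv : ∀ x, excess U c u x ^ q = U.indicator (fun y => Φ (u y)) x := by
    intro x
    by_cases hx : x ∈ U
    · simp [excess, Φ, hx]
    · simp [excess, hx, Real.zero_rpow (show q ≠ 0 by linarith)]
  have hlin : ∀ t, HasDerivAt (fun t : ℝ => 3 * (c - t)) (-3) t := fun t => by
    simpa using ((hasDerivAt_id t).const_sub c).const_mul 3
  have hpow : ∀ {p : ℝ}, 1 < p → ∀ t, HasDerivAt (fun t : ℝ => max (3 * (c - t)) 0 ^ p)
      (p * max (3 * (c - t)) 0 ^ (p - 1) * (-3)) t := fun {p} hp t =>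
    HasDerivAt.comp (h₂ := fun s => max s 0 ^ p) t
      (hasDerivAt_max_zero_rpow hp (3 * (c - t))) (hlin t)
  have hcont : ∀ {p : ℝ}, 0 ≤ p → Continuous fun t : ℝ => max (3 * (c - t)) 0 ^ p := fun hp =>
    (by fun_prop : Continuous fun t : ℝ => max (3 * (c - t)) 0).rpow_const fun _ => Or.inr hp
  have hΦ : ∀ t, HasDerivAt Φ (Φ' t) t := fun t => by
    convert hpow (show 1 < q by linarith) t using 1
    simp only [Φ']
    ring
  have hΦ' : Continuous Φ' := (hcont (by linarith)).const_mul _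
  have hH : ∀ t, HasDerivAt (fun t => Φ t * Φ' t) (H' t) t := fun t => by
    have h1 : (fun t => Φ t * Φ' t) = fun t => -3 * q * max (3 * (c - t)) 0 ^ (2 * q - 1) := by
      funext s
      simp only [Φ, Φ']
      rw [show 2 * q - 1 = q + (q - 1) by ring,
        Real.rpow_add_of_nonneg (le_max_right _ _) (by linarith) (by linarith)]
      ring
    rw [h1]
    refine ((hpow (show 1 < 2 * q - 1 by linarith) t).const_mul (-3 * q)).congr_deriv ?_
    simp only [H']
    rw [show 2 * q - 1 - 1 = 2 * q - 2 by ring]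
    ring
  have hH' : Continuous H' := (hcont (by linarith)).const_mul _
  have hle : ∀ t, Φ' t ^ 2 ≤ H' t := fun t => by
    have h1 : max (3 * (c - t)) 0 ^ (2 * q - 2) = (max (3 * (c - t)) 0 ^ (q - 1)) ^ 2 := by
      rw [← Real.rpow_mul_natCast (le_max_right _ _)]
      congr 1
      push_cast
      ring
    simp only [Φ', H', h1, mul_pow]
    have h2 : q ^ 2 ≤ q * (2 * q - 1) := by nlinarith
    nlinarith [mul_le_mul_of_nonneg_right h2 (sq_nonneg (max (3 * (c - t)) 0 ^ (q - 1)))]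
  simp only [hv] at h0 ⊢
  exact caccioppoli hκ hs hΦ hΦ' hH hH' hle hη hK hKU h0

end Excess

section Moser

variable {d : ℕ} {i₀ : Fin d} {κ c M : ℝ} {a : (Fin d → ℝ) → Fin d → Fin d → ℝ}
  {U : Set (Fin d → ℝ)} {u η : (Fin d → ℝ) → ℝ} {x₀ : Fin d → ℝ}

lemma abs_apply_le_of_mem_closedBall (h₀ : x₀ i₀ = 0) {r : ℝ} {x : Fin d → ℝ}
    (hx : x ∈ Metric.closedBall x₀ r) : |x i₀| ≤ r := by
  have := norm_le_pi_norm (x - x₀) i₀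
  rw [Pi.sub_apply, h₀, sub_zero, Real.norm_eq_abs] at this
  exact this.trans (by simpa [dist_eq_norm] using hx)

/-- Integrability of the quantities in Moser's iteration. -/
lemma integrable_cutoff_mul_excess (hU : IsOpen U) (hu : ContinuousOn u U)
    (hη : Continuous η) (hη0 : ∀ x ∉ Metric.closedBall x₀ 2, η x = 0)
    (hB : Metric.closedBall x₀ 2 ⊆ U) {b p : ℝ} (hb : 0 < b) (hp : 0 ≤ p) :
    Integrable fun x => η x ^ b * excess U c u x ^ p := by
  have hz : ∀ x ∉ Metric.closedBall x₀ 2, η x ^ b * excess U c u x ^ p = 0 := fun x hx => by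
    rw [hη0 x hx, Real.zero_rpow hb.ne', zero_mul]
  refine (ContinuousOn.continuous_of_eq_zero_off hU Metric.isClosed_closedBall hB hz
    ?_).integrable_of_hasCompactSupport (.intro (isCompact_closedBall x₀ 2) hz)
  exact (hη.rpow_const fun _ => Or.inr hb.le).continuousOn.mul
    ((continuousOn_excess hu).rpow_const fun _ _ => Or.inr hp)

/-- One step of Moser's iteration. -/
lemma moser_step (hd : 2 ≤ d) (hκ : 0 < κ) (hs : IsEllipticSolution κ i₀ a U u)
    (hη : ContDiff ℝ 1 η) (hη_nonneg : ∀ x, 0 ≤ η x) (hη1 : ∀ x, η x ≤ 1)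
    (hη0 : ∀ x ∉ Metric.closedBall x₀ 2, η x = 0) (hM : ∀ x, gradSq η x ≤ M)
    (h₀ : x₀ i₀ = 0) (hB : Metric.closedBall x₀ 2 ⊆ U) {b q : ℝ} (hb : 2 ≤ b) (hq : 2 ≤ q) :
    ∫ x, η x ^ ((d : ℝ) / (d - 1) * (b + 2)) * excess U c u x ^ (2 * ((d : ℝ) / (d - 1) * q)) ≤
      (d * ((1 + exp 4 * κ⁻¹ ^ 2 * M * ((b + 2) / 2) ^ 2) *
        ∫ x, η x ^ b * excess U c u x ^ (2 * q))) ^ ((d : ℝ) / (d - 1)) := by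
  set w := excess U c u with hw
  set p := (d : ℝ) / (d - 1) with hp
  have hw0 : ∀ x, 0 ≤ w x := excess_nonneg
  obtain ⟨s, hs2, hbs⟩ : ∃ s : ℝ, 2 ≤ s ∧ b = 2 * s - 2 := ⟨(b + 2) / 2, by linarith, by ring⟩
  have hss : (b + 2) / 2 = s := by rw [hbs]; ring
  rw [hss]
  have hηs : ContDiff ℝ 1 fun x => η x ^ s :=
    (Real.contDiff_rpow_const_of_le (by norm_num; linarith)).comp hη
  set g : (Fin d → ℝ) → ℝ := fun x => η x ^ s * w x ^ q with hg
  have hg0 : ∀ x ∉ Metric.closedBall x₀ 2, g x = 0 := fun x hx => by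
    simp only [hg]
    rw [hη0 x hx, Real.zero_rpow (by linarith), zero_mul]
  have hKc := isCompact_closedBall x₀ 2
  obtain ⟨hg1, hRi, hcac⟩ := caccioppoli_excess (c := c) hq hκ hs hηs hKc hB hg0
  have hgc : HasCompactSupport g := .intro hKc hg0
  have hA := integrable_cutoff_mul_excess (c := c) hs.isOpen hs.contDiffOn.continuousOn hη.continuous
    hη0 hB (show 0 < b by linarith) (show 0 ≤ 2 * q by linarith)
  set A := ∫ x, η x ^ b * w x ^ (2 * q) with hAdef
  have hwq : ∀ x, (w x ^ q) ^ 2 = w x ^ (2 * q) := fun x => by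
    rw [← Real.rpow_mul_natCast (hw0 x)]
    congr 1
    push_cast
    ring
  have hg2 : ∀ x, g x ^ 2 = η x ^ (b + 2) * w x ^ (2 * q) := fun x => by
    simp only [hg]
    rw [mul_pow, hwq, ← Real.rpow_mul_natCast (hη_nonneg x)]
    congr 2
    push_cast
    rw [hbs]
    ring
  have hgp : ∀ x, (g x ^ 2) ^ p = η x ^ (p * (b + 2)) * w x ^ (2 * (p * q)) := fun x => by
    rw [hg2, Real.mul_rpow (Real.rpow_nonneg (hη_nonneg x) _) (Real.rpow_nonneg (hw0 x) _),
      ← Real.rpow_mul (hη_nonneg x), ← Real.rpow_mul (hw0 x)]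
    congr 2 <;> ring
  have hgradcont : Continuous (gradSq g) := continuous_gradSq hg1
  have hgrad0 : ∀ x ∉ Metric.closedBall x₀ 2, gradSq g x = 0 := fun x hx =>
    gradSq_eq_zero_of_eventuallyEq_const (eventuallyEq_zero_off Metric.isClosed_closedBall hg0 hx)
  have hgi : Integrable fun x => g x ^ 2 := by
    refine (hg1.continuous.pow 2).integrable_of_hasCompactSupport (.intro hKc fun x hx => ?_)
    show g x ^ 2 = 0
    rw [hg0 x hx]
    norm_num
  have hgradi : Integrable (gradSq g) :=
    hgradcont.integrable_of_hasCompactSupport (.intro hKc hgrad0)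
  have hegradi : Integrable fun x => exp (x i₀) * gradSq g x :=
    Continuous.integrable_of_hasCompactSupport (by fun_prop)
      (.intro hKc fun x hx => by rw [hgrad0 x hx, mul_zero])
  have i1 : ∫ x, g x ^ 2 ≤ A := by
    refine integral_mono hgi hA fun x => ?_
    simp only [hg2]
    refine mul_le_mul_of_nonneg_right ?_ (Real.rpow_nonneg (hw0 x) _)
    refine Real.rpow_le_rpow_of_exponent_ge_of_imp (hη_nonneg x) (hη1 x) (by linarith) ?_
    intro _ h
    linarith
  have i2 : ∫ x, gradSq g x ≤ exp 2 * ∫ x, exp (x i₀) * gradSq g x := by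
    rw [← integral_const_mul]
    refine integral_mono hgradi (hegradi.const_mul _) fun x => ?_
    by_cases hx : x ∈ Metric.closedBall x₀ 2
    · have h1 := abs_le.1 (abs_apply_le_of_mem_closedBall h₀ hx)
      have h2 : 1 ≤ exp 2 * exp (x i₀) := by
        rw [← Real.exp_add]
        exact Real.one_le_exp (by linarith)
      have h3 := gradSq_nonneg (f := g) (x := x)
      dsimp only
      nlinarith
    · simp [hgrad0 x hx]
  have i3 : ∫ x, exp (x i₀) * ((w x ^ q) ^ 2 * gradSq (fun x => η x ^ s) x) ≤
      (exp 2 * s ^ 2 * M) * A := by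
    rw [← integral_const_mul]
    refine integral_mono hRi (hA.const_mul _) fun x => ?_
    have h1 : gradSq (fun x => η x ^ s) x = s ^ 2 * η x ^ b * gradSq η x := by
      rw [gradSq_comp (φ := fun t => t ^ s)
        (Real.hasDerivAt_rpow_const (x := η x) (p := s) (Or.inr (by linarith)))
        (hη.differentiable one_ne_zero x), mul_pow, ← Real.rpow_mul_natCast (hη_nonneg x)]
      congr 3
      push_cast
      rw [hbs]
      ring
    have h2 : 0 ≤ η x ^ b := Real.rpow_nonneg (hη_nonneg x) _
    have h3 : 0 ≤ w x ^ (2 * q) := Real.rpow_nonneg (hw0 x) _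
    have h4 := gradSq_nonneg (f := η) (x := x)
    dsimp only
    rw [h1, hwq]
    by_cases hx : x ∈ Metric.closedBall x₀ 2
    · have h5 : exp (x i₀) ≤ exp 2 :=
        Real.exp_le_exp.2 (abs_le.1 (abs_apply_le_of_mem_closedBall h₀ hx)).2
      calc exp (x i₀) * (w x ^ (2 * q) * (s ^ 2 * η x ^ b * gradSq η x))
          ≤ exp 2 * (w x ^ (2 * q) * (s ^ 2 * η x ^ b * M)) := by
            gcongr
            exact hM x
        _ = _ := by ring
    · rw [hη0 x hx, Real.zero_rpow (by linarith)]
      simp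
  have hA0 : 0 ≤ A := integral_nonneg fun x =>
    mul_nonneg (Real.rpow_nonneg (hη_nonneg x) _) (Real.rpow_nonneg (hw0 x) _)
  have hsob : ∫ x, (g x ^ 2) ^ p ≤ (d * ∫ x, (g x ^ 2 + gradSq g x)) ^ p :=
    integral_sq_rpow_le hd hg1 hgc
  simp only [hgp] at hsob
  have hd' : (2 : ℝ) ≤ d := by exact_mod_cast hd
  have hp0 : 0 ≤ p := div_nonneg (by linarith) (by linarith)
  refine hsob.trans (Real.rpow_le_rpow ?_ ?_ hp0)
  · refine mul_nonneg (by positivity) (integral_nonneg fun x => ?_)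
    have := gradSq_nonneg (f := g) (x := x)
    dsimp only
    positivity
  · rw [integral_add hgi hgradi]
    gcongr
    calc _ ≤ A + exp 2 * (κ⁻¹ ^ 2 * ((exp 2 * s ^ 2 * M) * A)) := by
          gcongr
          refine i2.trans ?_
          gcongr
          refine hcac.trans ?_
          gcongr
      _ = _ := by
          rw [show (4 : ℝ) = 2 + 2 by norm_num, Real.exp_add]
          ring

/-- The exponents of the cutoff in Moser's iteration. -/
noncomputable def moserExponent (p : ℝ) : ℕ → ℝ
  | 0 => 2
  | k + 1 => p * (moserExponent p k + 2)

lemma two_le_moserExponent {p : ℝ} (hp : 1 ≤ p) (k : ℕ) : 2 ≤ moserExponent p k := by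
  induction k with
  | zero => simp [moserExponent]
  | succ k ih =>
    rw [moserExponent]
    nlinarith

lemma moserExponent_le {p : ℝ} (hp : 1 ≤ p) (hp2 : p ≤ 2) (k : ℕ) :
    moserExponent p k ≤ 2 * 4 ^ k := by
  induction k with
  | zero => simp [moserExponent]
  | succ k ih =>
    have := two_le_moserExponent hp k
    rw [moserExponent, pow_succ]
    nlinarith

/-- **Local maximum principle** (Moser): if the excess is small in `L⁴` near `x₀`, then
`c - u x₀ ≤ 1 / 3`. -/
theorem exists_local_max_principle (hd : 2 ≤ d) (hκ : 0 < κ) (hM0 : 0 ≤ M) :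
    ∃ δ > 0, ∀ (i₀ : Fin d) (a : (Fin d → ℝ) → Fin d → Fin d → ℝ) (U : Set (Fin d → ℝ))
      (u η : (Fin d → ℝ) → ℝ) (x₀ : Fin d → ℝ) (c : ℝ), IsEllipticSolution κ i₀ a U u →
      ContDiff ℝ 1 η → (∀ x, 0 ≤ η x) → (∀ x, η x ≤ 1) →
      (∀ x ∉ Metric.closedBall x₀ 2, η x = 0) → (∀ x ∈ Metric.closedBall x₀ 1, η x = 1) →
      (∀ x, gradSq η x ≤ M) → x₀ i₀ = 0 → Metric.closedBall x₀ 2 ⊆ U →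
      ∫ x, (η x * excess U c u x ^ (2 : ℝ)) ^ 2 ≤ δ → c - 1 / 3 ≤ u x₀ := by
  have hd' : (2 : ℝ) ≤ d := by exact_mod_cast hd
  have hγ : (0 : ℝ) < 1 / (d - 1) := div_pos one_pos (by linarith)
  have hpγ : (d : ℝ) / (d - 1) = 1 + 1 / (d - 1) := by
    have : (d : ℝ) - 1 ≠ 0 := by linarith
    field_simp
    ring
  have hγ1 : (1 : ℝ) / (d - 1) ≤ 1 := by
    rw [div_le_one (by linarith)]
    linarith
  set p : ℝ := (d : ℝ) / (d - 1) with hp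
  have hp1 : 1 ≤ p := by linarith
  have hp2 : p ≤ 2 := by linarith
  obtain ⟨δ, hδ, hconv⟩ := exists_tendsto_zero_of_superlinear hγ
    (show 0 < (d : ℝ) * (1 + 4 * exp 4 * κ⁻¹ ^ 2 * M) by positivity)
  rw [← hpγ] at hconv
  refine ⟨δ, hδ, fun i₀ a U u η x₀ c hs hη hη_nonneg hη1 hη0 hη_one hM h₀ hB hsmall => ?_⟩
  set w := excess U c u with hw
  have hw0 : ∀ x, 0 ≤ w x := excess_nonneg
  let A : ℕ → ℝ := fun k => ∫ x, η x ^ moserExponent p k * w x ^ (2 * (2 * p ^ k))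
  have hpk : ∀ k, 2 ≤ 2 * p ^ k := fun k => by linarith [one_le_pow₀ (n := k) hp1]
  have hA0 : ∀ k, 0 ≤ A k := fun k => integral_nonneg fun x =>
    mul_nonneg (Real.rpow_nonneg (hη_nonneg x) _) (Real.rpow_nonneg (hw0 x) _)
  have hAi : ∀ k, Integrable fun x => η x ^ moserExponent p k * w x ^ (2 * (2 * p ^ k)) :=
    fun k => integrable_cutoff_mul_excess hs.isOpen hs.contDiffOn.continuousOn hη.continuous hη0 hB
      (by linarith [two_le_moserExponent hp1 k]) (by linarith [hpk k])
  have hlim : Tendsto A atTop (𝓝 0) := by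
    refine hconv A hA0 ?_ fun k => ?_
    · refine le_trans (le_of_eq ?_) hsmall
      refine integral_congr_ae (Eventually.of_forall fun x => ?_)
      simp only [moserExponent]
      rw [mul_pow, ← Real.rpow_mul_natCast (hw0 x), ← Real.rpow_natCast (η x) 2]
      norm_num
    · have hb := two_le_moserExponent hp1 k
      have h1 := moser_step (c := c) hd hκ hs hη hη_nonneg hη1 hη0 hM h₀ hB hb (hpk k)
      rw [← hp, ← hw] at h1
      have h2 : A (k + 1) = ∫ x, η x ^ (p * (moserExponent p k + 2)) *
          w x ^ (2 * (p * (2 * p ^ k))) := by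
        simp only [A, moserExponent, pow_succ]
        congr! 5
        ring
      rw [h2]
      change _ ≤ (d * (_ * A k)) ^ p at h1
      refine h1.trans ?_
      have h3 : (1 : ℝ) ≤ 4 ^ k := one_le_pow₀ (by norm_num)
      have h4 : ((moserExponent p k + 2) / 2) ^ 2 ≤ 4 * 16 ^ k := by
        have := moserExponent_le hp1 hp2 k
        calc ((moserExponent p k + 2) / 2) ^ 2 ≤ (2 * 4 ^ k) ^ 2 := by
              gcongr
              linarith
          _ = 4 * 16 ^ k := by
              rw [mul_pow, ← pow_mul, mul_comm k 2, pow_mul]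
              norm_num
      have h5 : (1 : ℝ) ≤ 16 ^ k := one_le_pow₀ (by norm_num)
      have h6 := hA0 k
      have h7 : 1 + exp 4 * κ⁻¹ ^ 2 * M * ((moserExponent p k + 2) / 2) ^ 2 ≤
          (1 + 4 * exp 4 * κ⁻¹ ^ 2 * M) * 16 ^ k := by
        calc _ ≤ 16 ^ k + exp 4 * κ⁻¹ ^ 2 * M * (4 * 16 ^ k) := by gcongr
          _ = _ := by ring
      refine Real.rpow_le_rpow ?_ ?_ (by linarith)
      · positivity
      · calc _ ≤ (d : ℝ) * (((1 + 4 * exp 4 * κ⁻¹ ^ 2 * M) * 16 ^ k) * A k) := by gcongr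
          _ = _ := by ring
  by_contra! hlt
  have hx₀U : x₀ ∈ U := hB (Metric.mem_closedBall_self (by norm_num))
  have hwx : 1 < w x₀ := by
    rw [hw, excess, indicator_of_mem hx₀U]
    exact lt_max_of_lt_left (by linarith)
  have hev : ∀ᶠ x in 𝓝 x₀, 1 < w x :=
    (((continuousOn_excess hs.contDiffOn.continuousOn).continuousAt
      (hs.isOpen.mem_nhds hx₀U)).eventually_const_lt hwx)
  obtain ⟨r, hr, hball⟩ := Metric.eventually_nhds_iff_ball.1
    (hev.and (Metric.closedBall_mem_nhds x₀ one_pos))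
  have hvol : 0 < volume.real (Metric.ball x₀ r) :=
    ENNReal.toReal_pos (Metric.measure_ball_pos volume x₀ hr).ne' measure_ball_lt_top.ne
  have hlow : ∀ k, volume.real (Metric.ball x₀ r) ≤ A k := by
    intro k
    rw [← integral_indicator_one Metric.isOpen_ball.measurableSet]
    refine integral_mono_of_nonneg (Eventually.of_forall fun x => indicator_nonneg (by simp) x)
      (hAi k) (Eventually.of_forall fun x => ?_)
    by_cases hx : x ∈ Metric.ball x₀ r
    · obtain ⟨h1, h2⟩ := hball x hx
      simp only [indicator_of_mem hx, Pi.one_apply]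
      rw [hη_one x h2, Real.one_rpow, one_mul]
      exact Real.one_le_rpow h1.le (by linarith [hpk k])
    · simp only [indicator_of_notMem hx]
      exact mul_nonneg (Real.rpow_nonneg (hη_nonneg x) _) (Real.rpow_nonneg (hw0 x) _)
  exact absurd (ge_of_tendsto' hlim hlow) (not_le.2 hvol)

end Moser

section Energy

variable {d : ℕ} {κ M : ℝ} {θ : (Fin d → ℝ) → ℝ}

lemma gradSq_smoothTransition_mul_cutoff_le {Mζ L : ℝ} {i₀ : Fin d}
    (hMζ : ∀ t, deriv Real.smoothTransition t ^ 2 ≤ Mζ) (hθ : ContDiff ℝ 1 θ)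
    (hθ0 : ∀ x, 0 ≤ θ x) (hθ1 : ∀ x, θ x ≤ 1) (hθM : ∀ x, gradSq θ x ≤ M) {x : Fin d → ℝ}
    (x₀ : Fin d → ℝ) (hx : x i₀ ≤ L) :
    exp (x i₀) * gradSq (fun x => Real.smoothTransition (x i₀ + (L - 1)) *
      θ (exp (-L) • (x - x₀))) x ≤ 2 * (exp (-L) * (M + exp 2 * Mζ)) := by
  have hζd : ∀ t, HasDerivAt Real.smoothTransition (deriv Real.smoothTransition t) t := fun t =>
    (Real.smoothTransition.contDiff (n := 1)).differentiable one_ne_zero t |>.hasDerivAt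
  have hζ' : HasDerivAt (fun t => Real.smoothTransition (t + (L - 1)))
      (deriv Real.smoothTransition (x i₀ + (L - 1))) (x i₀) :=
    (hζd _).comp_add_const _ _
  have h1 : gradSq (fun y : Fin d → ℝ => Real.smoothTransition (y i₀ + (L - 1))) x =
      deriv Real.smoothTransition (x i₀ + (L - 1)) ^ 2 :=
    gradSq_comp_apply (φ := fun t => Real.smoothTransition (t + (L - 1))) i₀ hζ'
  have h2 : gradSq (fun y : Fin d → ℝ => θ (exp (-L) • (y - x₀))) x =
      exp (-L) ^ 2 * gradSq θ (exp (-L) • (x - x₀)) := by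
    rw [gradSq_comp_sub (f := fun y => θ (exp (-L) • y)), gradSq_comp_smul]
  have hζdiff : DifferentiableAt ℝ
      (fun y : Fin d → ℝ => Real.smoothTransition (y i₀ + (L - 1))) x := by
    have := (hζd (x i₀ + (L - 1))).differentiableAt
    exact DifferentiableAt.comp (g := Real.smoothTransition) x this (by fun_prop)
  have hθdiff : DifferentiableAt ℝ (fun y : Fin d → ℝ => θ (exp (-L) • (y - x₀))) x :=
    (hθ.differentiable one_ne_zero).comp
      (by fun_prop : Differentiable ℝ fun y : Fin d → ℝ => exp (-L) • (y - x₀)) x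
  have h3 := gradSq_mul_le hζdiff hθdiff
  rw [h1, h2] at h3
  set z := exp (-L) • (x - x₀)
  have h4 : exp (x i₀) * exp (-L) ≤ 1 := by
    rw [← Real.exp_add, Real.exp_le_one_iff]
    linarith
  have h5 : exp (x i₀) * deriv Real.smoothTransition (x i₀ + (L - 1)) ^ 2 ≤
      exp (-L) * (exp 2 * Mζ) := by
    by_cases hx2 : x i₀ ≤ 2 - L
    · rw [← mul_assoc, ← Real.exp_add]
      gcongr
      · linarith
      · exact hMζ _
    · have : Real.smoothTransition =ᶠ[𝓝 (x i₀ + (L - 1))] fun _ => 1 := by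
        filter_upwards [lt_mem_nhds (show 1 < x i₀ + (L - 1) by linarith)] with s hs using
          Real.smoothTransition.one_of_one_le hs.le
      rw [this.deriv_eq]
      have := (sq_nonneg _).trans (hMζ 0)
      rw [deriv_const, zero_pow two_ne_zero, mul_zero]
      positivity
  have hs0 := Real.smoothTransition.nonneg (x i₀ + (L - 1))
  have hs1 := Real.smoothTransition.le_one (x i₀ + (L - 1))
  have h6 : Real.smoothTransition (x i₀ + (L - 1)) ^ 2 ≤ 1 := pow_le_one₀ hs0 hs1
  have h7 : θ z ^ 2 ≤ 1 := pow_le_one₀ (hθ0 z) (hθ1 z)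
  have h8 := gradSq_nonneg (f := θ) (x := z)
  have hM0 : 0 ≤ M := h8.trans (hθM z)
  calc _ ≤ exp (x i₀) * (2 * (Real.smoothTransition (x i₀ + (L - 1)) ^ 2 *
        (exp (-L) ^ 2 * gradSq θ z) +
        θ z ^ 2 * deriv Real.smoothTransition (x i₀ + (L - 1)) ^ 2)) := by gcongr
    _ ≤ exp (x i₀) * (2 * (1 * (exp (-L) ^ 2 * M) +
        1 * deriv Real.smoothTransition (x i₀ + (L - 1)) ^ 2)) := by
      gcongr
      exact hθM z
    _ = 2 * ((exp (x i₀) * exp (-L)) * exp (-L) * M +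
        exp (x i₀) * deriv Real.smoothTransition (x i₀ + (L - 1)) ^ 2) := by ring
    _ ≤ 2 * (1 * exp (-L) * M + exp (-L) * (exp 2 * Mζ)) := by gcongr
    _ = _ := by ring

/-- Energy estimate with a slowly varying weight: the excess is small near the middle hyperplane of
a wide slab. -/
theorem exists_excess_energy_le (hκ : 0 < κ) (hθ : ContDiff ℝ 1 θ)
    (hθ0 : ∀ x, 0 ≤ θ x) (hθ1 : ∀ x, θ x ≤ 1) (hθ_one : ∀ x, ‖x‖ ≤ 1 → θ x = 1)
    (hθ_zero : ∀ x, 2 ≤ ‖x‖ → θ x = 0) (hθM : ∀ x, gradSq θ x ≤ M) {δ : ℝ} (hδ : 0 < δ) :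
    ∃ L₀, 4 ≤ L₀ ∧ ∀ L, L₀ ≤ L → ∀ (i₀ : Fin d) (a : (Fin d → ℝ) → Fin d → Fin d → ℝ)
      (u : (Fin d → ℝ) → ℝ) (x₀ : Fin d → ℝ) (c : ℝ),
      IsEllipticSolution κ i₀ a {x | -L < x i₀ ∧ x i₀ < L} u →
      ContinuousOn u {x | -L ≤ x i₀ ∧ x i₀ ≤ L} →
      (∀ x : Fin d → ℝ, -L ≤ x i₀ → x i₀ ≤ L → 0 ≤ u x) → (∀ x : Fin d → ℝ, x i₀ = L → u x = 1) →
      c < 1 → x₀ i₀ = 0 →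
      ∫ x, (θ (x - x₀) * excess {x | -L < x i₀ ∧ x i₀ < L} c u x ^ (2 : ℝ)) ^ 2 ≤ δ := by
  obtain ⟨ψ, hψ, hψ0, hψε, hψi⟩ := exists_slowly_varying d (show 0 < κ ^ 2 / 16 by positivity)
  obtain ⟨Mζ, hMζ0, hMζ⟩ := exists_smoothTransition_deriv_sq_le
  obtain ⟨y₀, -, hy₀⟩ := (isCompact_closedBall (0 : Fin d → ℝ) 2).exists_isMinOn
    ⟨0, by simp⟩ hψ.continuous.continuousOn
  have hm : 0 < ψ y₀ := hψ0 y₀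
  have hM0 : 0 ≤ M := gradSq_nonneg.trans (hθM 0)
  set N : ℝ := 324 * (M + exp 2 * Mζ) with hN
  have hN0 : 0 ≤ N := by positivity
  set Ψ : ℝ := ∫ x, ψ x ^ 2 with hΨ
  have hΨ0 : 0 ≤ Ψ := integral_nonneg fun x => sq_nonneg _
  set B : ℝ := exp 2 / ψ y₀ ^ 2 * (8 * κ⁻¹ ^ 2 * N * Ψ) with hB
  have hB0 : 0 ≤ B := by positivity
  refine ⟨max 4 (B / δ), le_max_left _ _, fun L hL i₀ a u x₀ c hs huc hu0 hu1 hc hx₀ => ?_⟩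
  have hL4 : 4 ≤ L := (le_max_left _ _).trans hL
  have hLB : B * exp (-L) ≤ δ := by
    have h1 : B / δ ≤ L := (le_max_right _ _).trans hL
    rw [div_le_iff₀ hδ] at h1
    rw [Real.exp_neg, ← div_eq_mul_inv, div_le_iff₀ (Real.exp_pos _)]
    nlinarith [Real.add_one_le_exp L]
  set U : Set (Fin d → ℝ) := {x | -L < x i₀ ∧ x i₀ < L} with hU
  set v : (Fin d → ℝ) → ℝ := fun x => excess U c u x ^ (2 : ℝ) with hv
  have hvU : ∀ x ∉ U, v x = 0 := fun x hx => by simp [hv, excess, hx]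
  have hv2 : ∀ x, v x ^ 2 ≤ 81 := fun x => by
    have h0 : 0 ≤ excess U c u x := excess_nonneg x
    have h3 : excess U c u x ≤ 3 := by
      by_cases hx : x ∈ U
      · rw [excess, indicator_of_mem hx]
        have := hu0 x hx.1.le hx.2.le
        exact max_le (by linarith) (by norm_num)
      · rw [excess, indicator_of_notMem hx]
        norm_num
    have : v x = excess U c u x ^ 2 := by simp only [hv]; norm_num
    rw [this, ← pow_mul]
    calc _ ≤ (3 : ℝ) ^ (2 * 2) := by gcongr
      _ = 81 := by norm_num
  set χ : (Fin d → ℝ) → ℝ := fun x => Real.smoothTransition (x i₀ + (L - 1)) *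
    θ (exp (-L) • (x - x₀)) with hχ
  have hχ1 : ContDiff ℝ 1 χ := by
    refine ContDiff.mul ?_ ?_
    · exact Real.smoothTransition.contDiff.comp
        (by fun_prop : ContDiff ℝ 1 fun x : Fin d → ℝ => x i₀ + (L - 1))
    · exact hθ.comp (by fun_prop : ContDiff ℝ 1 fun x : Fin d → ℝ => exp (-L) • (x - x₀))
  have hψ1 : ContDiff ℝ 1 fun x => ψ (x - x₀) := hψ.comp (by fun_prop)
  set η : (Fin d → ℝ) → ℝ := fun x => χ x * ψ (x - x₀) with hηdef
  have hη : ContDiff ℝ 1 η := hχ1.mul hψ1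
  let K : Set (Fin d → ℝ) := Metric.closedBall x₀ (2 * exp L) ∩
    ({x | -L + 1 ≤ x i₀ ∧ x i₀ ≤ L} ∩ u ⁻¹' Iic c)
  have hS : IsClosed {x : Fin d → ℝ | -L + 1 ≤ x i₀ ∧ x i₀ ≤ L} :=
    (isClosed_le continuous_const (continuous_apply i₀)).inter
      (isClosed_le (continuous_apply i₀) continuous_const)
  have hK : IsCompact K := (isCompact_closedBall _ _).inter_right <|
    (huc.mono fun x hx => ⟨by linarith [hx.1], hx.2⟩).preimage_isClosed_of_isClosed hS isClosed_Iic
  have hKU : K ⊆ U := by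
    rintro x ⟨-, ⟨hx1, hx2⟩, hxc⟩
    refine ⟨by linarith, lt_of_le_of_ne hx2 fun h => ?_⟩
    have : u x ≤ c := hxc
    linarith [hu1 x h]
  have h0 : ∀ x ∉ K, η x * excess U c u x ^ (2 : ℝ) = 0 := by
    intro x hx
    by_cases hxU : x ∈ U
    · by_cases hxb : x ∈ Metric.closedBall x₀ (2 * exp L)
      · by_cases hx1 : -L + 1 ≤ x i₀
        · have hxc : c < u x := not_le.1 fun h => hx ⟨hxb, ⟨hx1, hxU.2.le⟩, h⟩
          rw [excess, indicator_of_mem hxU, max_eq_right (by linarith)]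
          norm_num
        · simp only [η, χ]
          rw [Real.smoothTransition.zero_of_nonpos (by linarith)]
          simp
      · simp only [η, χ]
        rw [hθ_zero, mul_zero, zero_mul, zero_mul]
        rw [Metric.mem_closedBall, dist_eq_norm, not_le] at hxb
        rw [norm_smul, Real.norm_eq_abs, abs_of_pos (Real.exp_pos _), Real.exp_neg,
          inv_mul_eq_div, le_div_iff₀ (Real.exp_pos _)]
        exact hxb.le
    · rw [show excess U c u x ^ (2 : ℝ) = 0 from hvU x hxU, mul_zero]
  obtain ⟨hg1, hRi, hcac⟩ := caccioppoli_excess le_rfl hκ hs hη hK hKU h0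
  have hgc : HasCompactSupport fun x => η x * excess U c u x ^ (2 : ℝ) := .intro hK h0
  have hhardy := integral_exp_mul_sq_le i₀ hg1 hgc
  set I : ℝ := ∫ x, exp (x i₀) * (η x * excess U c u x ^ (2 : ℝ)) ^ 2 with hI
  have hIi : Integrable fun x => exp (x i₀) * (η x * excess U c u x ^ (2 : ℝ)) ^ 2 := by
    refine Continuous.integrable_of_hasCompactSupport ?_ (.intro hK fun x hx => ?_)
    · have := hg1.continuous
      fun_prop
    · rw [h0 x hx]
      norm_num
  have hpt : ∀ x, exp (x i₀) * ((excess U c u x ^ (2 : ℝ)) ^ 2 * gradSq η x) ≤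
      κ ^ 2 / 8 * (exp (x i₀) * (η x * excess U c u x ^ (2 : ℝ)) ^ 2) +
        N * exp (-L) * ψ (x - x₀) ^ 2 := by
    intro x
    change exp (x i₀) * (v x ^ 2 * gradSq η x) ≤
      κ ^ 2 / 8 * (exp (x i₀) * (η x * v x) ^ 2) + _
    by_cases hx : x ∈ U
    · have e1 : gradSq η x ≤ 2 * (χ x ^ 2 * (κ ^ 2 / 16 * ψ (x - x₀) ^ 2) +
          ψ (x - x₀) ^ 2 * gradSq χ x) := by
        refine (gradSq_mul_le (hχ1.differentiable one_ne_zero x)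
          (hψ1.differentiable one_ne_zero x)).trans ?_
        rw [gradSq_comp_sub]
        gcongr
        exact hψε _
      have e2 : exp (x i₀) * gradSq χ x ≤ 2 * (exp (-L) * (M + exp 2 * Mζ)) :=
        gradSq_smoothTransition_mul_cutoff_le hMζ hθ hθ0 hθ1 hθM x₀ hx.2.le
      have e3 := hv2 x
      calc _ ≤ exp (x i₀) * (v x ^ 2 * (2 * (χ x ^ 2 * (κ ^ 2 / 16 * ψ (x - x₀) ^ 2) +
            ψ (x - x₀) ^ 2 * gradSq χ x))) := by gcongr
        _ = κ ^ 2 / 8 * (exp (x i₀) * (η x * v x) ^ 2) +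
            2 * v x ^ 2 * ψ (x - x₀) ^ 2 * (exp (x i₀) * gradSq χ x) := by
          simp only [η]
          ring
        _ ≤ κ ^ 2 / 8 * (exp (x i₀) * (η x * v x) ^ 2) +
            2 * 81 * ψ (x - x₀) ^ 2 * (2 * (exp (-L) * (M + exp 2 * Mζ))) := by
          have := gradSq_nonneg (f := χ) (x := x)
          gcongr
        _ = _ := by
          rw [hN]
          ring
    · rw [hvU x hx]
      simp only [mul_zero, zero_mul, ne_eq, OfNat.ofNat_ne_zero, not_false_eq_true, zero_pow,
        zero_add]
      positivity
  have hψi' : Integrable fun x => ψ (x - x₀) ^ 2 := hψi.comp_sub_right x₀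
  have hJ : ∫ x, exp (x i₀) * ((excess U c u x ^ (2 : ℝ)) ^ 2 * gradSq η x) ≤
      κ ^ 2 / 8 * I + N * exp (-L) * Ψ := by
    refine (integral_mono hRi ((hIi.const_mul _).add (hψi'.const_mul _)) hpt).trans_eq ?_
    rw [integral_add' (hIi.const_mul _) (hψi'.const_mul _), integral_const_mul, integral_const_mul,
      integral_sub_right_eq_self (fun x => ψ x ^ 2) x₀]
  have hIle : I ≤ 8 * κ⁻¹ ^ 2 * N * Ψ * exp (-L) := by
    have h1 : I ≤ 4 * (κ⁻¹ ^ 2 * (κ ^ 2 / 8 * I + N * exp (-L) * Ψ)) := by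
      refine hhardy.trans ?_
      gcongr
      refine hcac.trans ?_
      gcongr
    have h2 : 4 * (κ⁻¹ ^ 2 * (κ ^ 2 / 8 * I + N * exp (-L) * Ψ)) =
        I / 2 + 4 * κ⁻¹ ^ 2 * N * Ψ * exp (-L) := by
      field_simp
      ring
    linarith
  have hfin : ∀ x, (θ (x - x₀) * v x) ^ 2 ≤
      exp 2 / ψ y₀ ^ 2 * (exp (x i₀) * (η x * v x) ^ 2) := by
    intro x
    by_cases hx : x ∈ Metric.closedBall x₀ 2
    · have hxi := abs_le.1 (abs_apply_le_of_mem_closedBall hx₀ hx)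
      rw [Metric.mem_closedBall, dist_eq_norm] at hx
      have e1 : χ x = 1 := by
        simp only [χ]
        rw [Real.smoothTransition.one_of_one_le (by linarith), hθ_one, one_mul]
        rw [norm_smul, Real.norm_eq_abs, abs_of_pos (Real.exp_pos _), Real.exp_neg,
          inv_mul_eq_div, div_le_one (Real.exp_pos _)]
        linarith [Real.add_one_le_exp L]
      have e2 : ψ y₀ ≤ ψ (x - x₀) := hy₀ (by simpa using hx)
      have e3 : 1 ≤ exp 2 * exp (x i₀) := by
        rw [← Real.exp_add]
        exact Real.one_le_exp (by linarith)
      have e4 : θ (x - x₀) ^ 2 ≤ 1 := pow_le_one₀ (hθ0 _) (hθ1 _)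
      have e5 : 1 ≤ ψ (x - x₀) ^ 2 / ψ y₀ ^ 2 := by
        rw [one_le_div (by positivity)]
        gcongr
      calc _ = θ (x - x₀) ^ 2 * v x ^ 2 := by ring
        _ ≤ ((exp 2 * exp (x i₀)) * (ψ (x - x₀) ^ 2 / ψ y₀ ^ 2)) * v x ^ 2 := by
          gcongr
          exact e4.trans (one_le_mul_of_one_le_of_one_le e3 e5)
        _ = _ := by
          simp only [η, e1]
          ring
    · rw [Metric.mem_closedBall, dist_eq_norm, not_le] at hx
      rw [hθ_zero _ hx.le, zero_mul]
      have := hψ0 y₀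
      simp only [ne_eq, OfNat.ofNat_ne_zero, not_false_eq_true, zero_pow]
      positivity
  calc _ ≤ ∫ x, exp 2 / ψ y₀ ^ 2 * (exp (x i₀) * (η x * v x) ^ 2) :=
        integral_mono_of_nonneg (Eventually.of_forall fun x => sq_nonneg _) (hIi.const_mul _)
          (Eventually.of_forall hfin)
    _ = exp 2 / ψ y₀ ^ 2 * I := integral_const_mul _ _
    _ ≤ exp 2 / ψ y₀ ^ 2 * (8 * κ⁻¹ ^ 2 * N * Ψ * exp (-L)) := by gcongr
    _ = B * exp (-L) := by rw [hB]; ring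
    _ ≤ δ := hLB

end Energy

lemma interior_slab {d : ℕ} (i₀ : Fin d) (L : ℝ) :
    interior {x : Fin d → ℝ | -L ≤ x i₀ ∧ x i₀ ≤ L} = {x | -L < x i₀ ∧ x i₀ < L} := by
  have := (isOpenMap_eval (X := fun _ : Fin d => ℝ) i₀).preimage_interior_eq_interior_preimage
    (continuous_apply i₀) (Icc (-L) L)
  rw [interior_Icc] at this
  exact this.symm

theorem slab_exit_probability_lower_bound
    (d : ℕ) (hd : 2 ≤ d) (κ : ℝ) (hκ0 : 0 < κ) (hκ1 : κ ≤ 1) :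
    ∃ L₀ : ℝ, 0 < L₀ ∧
      ∀ L : ℝ, L₀ ≤ L →
      ∀ a : (Fin d → ℝ) → Fin d → Fin d → ℝ,
        ContDiff ℝ (⊤ : ℕ∞) a →
        (∀ x i j, a x i j = a x j i) →
        (∀ x y : Fin d → ℝ,
          κ * ∑ i, (y i) ^ 2 ≤ ∑ i, ∑ j, y i * a x i j * y j ∧
          ∑ i, ∑ j, y i * a x i j * y j ≤ κ⁻¹ * ∑ i, (y i) ^ 2) →
      ∀ Slab : Set (Fin d → ℝ),
        Slab = {x | -L ≤ x ⟨0, by omega⟩ ∧ x ⟨0, by omega⟩ ≤ L} →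
      ∀ u : (Fin d → ℝ) → ℝ,
        ContinuousOn u Slab →
        ContDiffOn ℝ 2 u (interior Slab) →
        (∀ x ∈ Slab, 0 ≤ u x ∧ u x ≤ 1) →
        (∀ x ∈ interior Slab,
          (∑ i, fderiv ℝ
              (fun y => ∑ j, a y i j * fderiv ℝ u y (Pi.single j 1))
              x (Pi.single i 1))
            + ∑ j, a x ⟨0, by omega⟩ j * fderiv ℝ u x (Pi.single j 1) = 0) →
        (∀ x : Fin d → ℝ, x ⟨0, by omega⟩ = -L → u x = 0) →
        (∀ x : Fin d → ℝ, x ⟨0, by omega⟩ = L → u x = 1) →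
        ∀ x : Fin d → ℝ, x ⟨0, by omega⟩ = 0 → 2 / 3 ≤ u x := by
  obtain ⟨θ, M, hθ, hM0, hθ0, hθ1, hθ_one, hθ_zero, hθM⟩ := exists_cutoff d
  obtain ⟨δ, hδ, hmax⟩ := exists_local_max_principle hd hκ0 hM0
  obtain ⟨L₀, hL₀, henergy⟩ :=
    exists_excess_energy_le hκ0 hθ hθ0 hθ1 hθ_one hθ_zero hθM hδ
  refine ⟨L₀, by linarith, ?_⟩
  rintro L hL a ha hsymm hell Slab rfl u huc hu h01 heq - hu1 x₀ hx₀
  rw [interior_slab] at hu heq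
  have hs : IsEllipticSolution κ ⟨0, by omega⟩ a
      {x | -L < x ⟨0, by omega⟩ ∧ x ⟨0, by omega⟩ < L} u :=
    { contDiff_coeff := ha.of_le (by exact_mod_cast le_top)
      symm := hsymm
      elliptic := hell
      isOpen := interior_slab (⟨0, by omega⟩ : Fin d) L ▸ isOpen_interior
      contDiffOn := hu
      equation := heq }
  by_contra! hlt
  have hB : Metric.closedBall x₀ 2 ⊆ {x | -L < x ⟨0, by omega⟩ ∧ x ⟨0, by omega⟩ < L} :=
    fun x hx => by
      have := abs_le.1 (abs_apply_le_of_mem_closedBall hx₀ hx)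
      exact ⟨by linarith, by linarith⟩
  have h := hmax _ a _ u (fun x => θ (x - x₀)) x₀ ((u x₀ + 4 / 3) / 2) hs
    (hθ.comp (by fun_prop)) (fun x => hθ0 _) (fun x => hθ1 _)
    (fun x hx => hθ_zero _ (by simpa [dist_eq_norm] using (not_le.1 hx).le))
    (fun x hx => hθ_one _ (by simpa [dist_eq_norm] using hx))
    (fun x => by rw [gradSq_comp_sub]; exact hθM _) hx₀ hB
    (henergy L hL _ a u x₀ _ hs huc (fun x h1 h2 => (h01 x ⟨h1, h2⟩).1) hu1 (by linarith) hx₀)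
  linarith
end
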